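/- arXiv:2201.05031 — 3 statements merged into one kernel-verified Lean document; each statement's English description precedes it below -/
import Mathlib

section
/- Let g ∈ ℕ₊ and let a ∈ ℕ^d be a multi-index with |a| ≤ g. There exists a constant C = C(d, σ, g, a) > 0 such that for every bounded continuous function f : ℝ^d → ℝ and every μ > 0, the convolution K_μ^{*g} ∗ f has a continuous partial derivative ∂^a(K_μ^{*g} ∗ f) and ‖∂^a (K_μ^{*g} ∗ f)‖_{L^∞(ℝ^d)} ≤ C [μ]^{−|a|} ‖f‖_{L^∞(ℝ^d)}. -/
open MeasureTheory ENNReal Real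

/-- The kernel `K_μ` (density, valued in `[0,∞]`). -/
noncomputable def Kker (d : ℕ) (σ μ : ℝ) (x : Fin d → ℝ) : ℝ≥0∞ :=
  ∫⁻ t in Set.Ioi (0 : ℝ), ENNReal.ofReal
    (Real.exp (-t) * (4 * π * t * μ ^ ((2 : ℝ) / σ)) ^ (-(d : ℝ) / 2) *
      Real.exp (-(∑ i, x i ^ 2) / (4 * t * μ ^ ((2 : ℝ) / σ))))

/-- The kernel `K_μ` as a measure on `ℝ^d`. -/
noncomputable def Kmeas (d : ℕ) (σ μ : ℝ) : Measure (Fin d → ℝ) :=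
  volume.withDensity (Kker d σ μ)

/-- Convolution powers `K_μ^{*g}` as measures; `K_μ^{*0} = δ₀`. -/
noncomputable def Kpow (d : ℕ) (σ μ : ℝ) : ℕ → Measure (Fin d → ℝ)
  | 0 => Measure.dirac 0
  | g + 1 => (Kmeas d σ μ).conv (Kpow d σ μ g)

/-- Convolution of a measure with a function: `(ρ ∗ f)(x) = ∫ f(x−z) ρ(dz)`. -/
noncomputable def measConv (d : ℕ) (ρ : Measure (Fin d → ℝ)) (f : (Fin d → ℝ) → ℝ) :
    (Fin d → ℝ) → ℝ := fun x => ∫ z, f (x - z) ∂ρ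

/-- Partial derivative in the `i`-th coordinate direction. -/
noncomputable def pder (d : ℕ) (i : Fin d) (f : (Fin d → ℝ) → ℝ) : (Fin d → ℝ) → ℝ :=
  fun x => fderiv ℝ f x (Pi.single i 1)

/-- Iterated partial derivative `∂^a` for a multi-index `a ∈ ℕ^d`. -/
noncomputable def mpder (d : ℕ) (a : Fin d → ℕ) (f : (Fin d → ℝ) → ℝ) : (Fin d → ℝ) → ℝ :=
  (List.finRange d).foldr (fun i g => (pder d i)^[a i] g) f

section Translation

variable {Ω E F : Type*} [MeasurableSpace Ω] [AddGroup E] [MeasurableSpace E] [MeasurableAdd E]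
  {τ : Measure Ω} [SFinite τ] {m : Measure E} [SFinite m] [m.IsAddRightInvariant]
  [NormedAddCommGroup F]

theorem integral_prod_snd_add [NormedSpace ℝ F] (h : Ω × E → F) (w : E) :
    ∫ p, h (p.1, p.2 + w) ∂τ.prod m = ∫ p, h p ∂τ.prod m :=
  ((MeasurePreserving.id τ).prod (measurePreserving_add_right m w)).integral_comp
    ((MeasurableEquiv.refl Ω).prodCongr (MeasurableEquiv.addRight w)).measurableEmbedding h

theorem integrable_prod_snd_add {h : Ω × E → F} (hh : Integrable h (τ.prod m)) (w : E) :
    Integrable (fun p => h (p.1, p.2 + w)) (τ.prod m) :=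
  ((MeasurePreserving.id τ).prod (measurePreserving_add_right m w)).integrable_comp_of_integrable hh

end Translation

theorem integrable_smul_kernel {Ω E F : Type*} [MeasurableSpace Ω] [NormedAddCommGroup E]
    [MeasurableSpace E] [BorelSpace E] {τ : Measure Ω} {m : Measure E} {f : E → ℝ} {M : ℝ}
    [NormedAddCommGroup F] [NormedSpace ℝ F] (hf : Continuous f) (hfM : ∀ x, ‖f x‖ ≤ M)
    {h : Ω × E → F} (hh : Integrable h (τ.prod m)) (x : E) :
    Integrable (fun p => f (x - p.2) • h p) (τ.prod m) :=
  hh.bdd_smul M (hf.measurable.comp (f := fun p : Ω × E => x - p.2)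
    (by fun_prop)).aestronglyMeasurable (ae_of_all _ fun _ => hfM _)

theorem continuous_integral_smul_kernel {Ω E F : Type*} [MeasurableSpace Ω]
    [NormedAddCommGroup E] [MeasurableSpace E] [BorelSpace E] {τ : Measure Ω} {m : Measure E}
    {f : E → ℝ} {M : ℝ} [NormedAddCommGroup F] [NormedSpace ℝ F]
    (hf : Continuous f) (hfM : ∀ x, ‖f x‖ ≤ M)
    {h : Ω × E → F} (hh : Integrable h (τ.prod m)) :
    Continuous fun x => ∫ p, f (x - p.2) • h p ∂τ.prod m := by
  refine continuous_of_dominated (bound := fun p => M * ‖h p‖)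
    (fun x => (integrable_smul_kernel hf hfM hh x).aestronglyMeasurable)
    (fun x => ae_of_all _ fun p => ?_) (hh.norm.const_mul M)
    (ae_of_all _ fun p => by fun_prop)
  rw [norm_smul]
  exact mul_le_mul_of_nonneg_right (hfM _) (norm_nonneg _)

section TranslatedKernel

variable {Ω E : Type*} [MeasurableSpace Ω] [NormedAddCommGroup E] [NormedSpace ℝ E]
  [MeasurableSpace E] [BorelSpace E] [SecondCountableTopology E]
  {τ : Measure Ω} [SFinite τ] {m : Measure E} [SFinite m] [m.IsAddRightInvariant]

variable {f : E → ℝ} {M : ℝ} {G : Ω → E → ℝ} {D : Ω → E → E →L[ℝ] ℝ}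

theorem integrable_prod_shear (hDm : StronglyMeasurable (Function.uncurry D))
    (hDi : Integrable (Function.uncurry D) (τ.prod m)) (v : E) (ν : Measure ℝ)
    [IsFiniteMeasure ν] :
    Integrable (fun q : ℝ × Ω × E => D q.2.1 (q.2.2 + q.1 • v) v) (ν.prod (τ.prod m)) := by
  have hm : Measurable fun q : ℝ × Ω × E => (q.2.1, q.2.2 + q.1 • v) := by fun_prop
  have hv : Integrable (fun p : Ω × E => D p.1 p.2 v) (τ.prod m) :=
    hDi.apply_continuousLinearMap v
  refine (integrable_prod_iff ?_).2 ⟨ae_of_all _ fun r => ?_, ?_⟩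
  · exact ((ContinuousLinearMap.apply ℝ ℝ v).continuous.comp_stronglyMeasurable
      (hDm.comp_measurable hm)).aestronglyMeasurable
  · exact integrable_prod_snd_add hv (r • v)
  · have (r : ℝ) : ∫ p : Ω × E, ‖D p.1 (p.2 + r • v) v‖ ∂τ.prod m
        = ∫ p : Ω × E, ‖D p.1 p.2 v‖ ∂τ.prod m :=
      integral_prod_snd_add (fun p : Ω × E => ‖D p.1 p.2 v‖) (r • v)
    simp only [this]
    exact integrable_const _

theorem integral_kernel_add_sub (hf : Continuous f) (hfM : ∀ x, ‖f x‖ ≤ M)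
    (hGD : ∀ ω z, HasFDerivAt (G ω) (D ω z) z) (hDc : ∀ ω, Continuous (D ω))
    (hGi : Integrable (Function.uncurry G) (τ.prod m))
    (hDm : StronglyMeasurable (Function.uncurry D))
    (hDi : Integrable (Function.uncurry D) (τ.prod m)) (x v : E) :
    (∫ p, f (x + v - p.2) • G p.1 p.2 ∂τ.prod m) - ∫ p, f (x - p.2) • G p.1 p.2 ∂τ.prod m
      = ∫ r in (0 : ℝ)..1, (∫ p, f (x + r • v - p.2) • D p.1 p.2 ∂τ.prod m) v := by
  have hshift (w : E) {F : Type _} [NormedAddCommGroup F] [NormedSpace ℝ F] (h : Ω → E → F) :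
      ∫ p, f (x + w - p.2) • h p.1 p.2 ∂τ.prod m
        = ∫ p, f (x - p.2) • h p.1 (p.2 + w) ∂τ.prod m := by
    rw [← integral_prod_snd_add (fun p : Ω × E => f (x + w - p.2) • h p.1 p.2) w]
    simp only [add_sub_add_right_eq_sub]
  have hline (ω : Ω) (z : E) : G ω (z + v) - G ω z = ∫ r in (0 : ℝ)..1, D ω (z + r • v) v := by
    have hd (r : ℝ) : HasDerivAt (fun r : ℝ => G ω (z + r • v)) (D ω (z + r • v) v) r := by
      have : HasDerivAt (fun r : ℝ => z + r • v) v r := by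
        simpa using ((hasDerivAt_id r).smul_const v).const_add z
      exact (hGD ω _).comp_hasDerivAt r this
    rw [intervalIntegral.integral_eq_sub_of_hasDerivAt (fun r _ => hd r)
      (Continuous.intervalIntegrable (by have := hDc ω; fun_prop) _ _)]
    simp
  have hGv := integrable_smul_kernel (F := ℝ) hf hfM (integrable_prod_snd_add hGi v) x
  have hG0 := integrable_smul_kernel (F := ℝ) hf hfM hGi x
  rw [hshift v G]
  simp only [Function.uncurry] at hGv hG0
  rw [← integral_sub hGv hG0]
  have hswap := integral_integral_swap (μ := volume.restrict (Set.Ioc (0 : ℝ) 1)) (ν := τ.prod m)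
    (f := fun r p => f (x - p.2) • D p.1 (p.2 + r • v) v) (by
      have := integrable_prod_shear (τ := τ) (m := m) hDm hDi v
        (volume.restrict (Set.Ioc (0 : ℝ) 1))
      exact this.bdd_smul M
        (hf.measurable.comp (f := fun q : ℝ × Ω × E => x - q.2.2)
          (by fun_prop)).aestronglyMeasurable (ae_of_all _ fun _ => hfM _))
  rw [intervalIntegral.integral_of_le zero_le_one]
  calc _ = ∫ p : Ω × E, (∫ r in Set.Ioc (0 : ℝ) 1, f (x - p.2) • D p.1 (p.2 + r • v) v) ∂τ.prod m := by
        refine integral_congr_ae (ae_of_all _ fun p => ?_)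
        simp only
        rw [← smul_sub, hline, intervalIntegral.integral_of_le zero_le_one, integral_smul]
    _ = _ := by
        rw [← hswap]
        refine integral_congr_ae (ae_of_all _ fun r => ?_)
        simp only
        have hi : Integrable (fun p : Ω × E => f (x + r • v - p.2) • D p.1 p.2) (τ.prod m) :=
          integrable_smul_kernel hf hfM hDi (x + r • v)
        rw [ContinuousLinearMap.integral_apply hi]
        simp only [smul_apply]
        exact (hshift (r • v) (fun ω z => D ω z v)).symm

theorem hasFDerivAt_integral_kernel (hf : Continuous f) (hfM : ∀ x, ‖f x‖ ≤ M)
    (hGD : ∀ ω z, HasFDerivAt (G ω) (D ω z) z) (hDc : ∀ ω, Continuous (D ω))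
    (hGi : Integrable (Function.uncurry G) (τ.prod m))
    (hDm : StronglyMeasurable (Function.uncurry D))
    (hDi : Integrable (Function.uncurry D) (τ.prod m)) (x : E) :
    HasFDerivAt (fun x => ∫ p, f (x - p.2) • G p.1 p.2 ∂τ.prod m)
      (∫ p, f (x - p.2) • D p.1 p.2 ∂τ.prod m) x := by
  have hS : Continuous fun x => ∫ p, f (x - p.2) • D p.1 p.2 ∂τ.prod m :=
    continuous_integral_smul_kernel hf hfM hDi
  set S := fun x => ∫ p, f (x - p.2) • D p.1 p.2 ∂τ.prod m with hSdef
  rw [hasFDerivAt_iff_isLittleO_nhds_zero, Asymptotics.isLittleO_iff]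
  intro c hc
  obtain ⟨δ, hδ, hball⟩ := Metric.continuousAt_iff.1 hS.continuousAt c hc
  filter_upwards [Metric.ball_mem_nhds (0 : E) hδ] with v hv
  rw [mem_ball_zero_iff] at hv
  rw [integral_kernel_add_sub hf hfM hGD hDc hGi hDm hDi x v]
  have hconst : S x v = ∫ _ in (0 : ℝ)..1, S x v := by simp
  change ‖(∫ r in (0 : ℝ)..1, S (x + r • v) v) - S x v‖ ≤ _
  rw [hconst, ← intervalIntegral.integral_sub
    (Continuous.intervalIntegrable (by fun_prop) _ _) (by simp)]
  refine (intervalIntegral.norm_integral_le_of_norm_le_const (C := c * ‖v‖) fun r hr => ?_).trans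
    (by simp)
  rw [Set.uIoc_of_le zero_le_one] at hr
  rw [← sub_apply]
  refine (ContinuousLinearMap.le_opNorm _ _).trans
    (mul_le_mul_of_nonneg_right ?_ (norm_nonneg _))
  rw [← dist_eq_norm]
  refine (hball ?_).le
  rw [dist_eq_norm, add_sub_cancel_left, norm_smul, Real.norm_of_nonneg hr.1.le]
  exact (mul_le_of_le_one_left (norm_nonneg _) hr.2).trans_lt hv

end TranslatedKernel

section Gaussian

variable {d : ℕ}

theorem exp_neg_sum_sq_div (z : Fin d → ℝ) (c : ℝ) :
    Real.exp (-(∑ i, z i ^ 2) / c) = ∏ i, Real.exp (-c⁻¹ * z i ^ 2) := by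
  rw [← Real.exp_sum, ← Finset.mul_sum]
  congr 1
  ring

theorem integrable_exp_neg_sum_sq_div {c : ℝ} (hc : 0 < c) :
    Integrable fun z : Fin d → ℝ => Real.exp (-(∑ i, z i ^ 2) / c) := by
  simp only [exp_neg_sum_sq_div]
  exact Integrable.fintype_prod (f := fun _ x => Real.exp (-c⁻¹ * x ^ 2))
    fun _ => integrable_exp_neg_mul_sq (inv_pos.2 hc)

theorem integral_exp_neg_sum_sq_div {c : ℝ} (hc : 0 < c) :
    ∫ z : Fin d → ℝ, Real.exp (-(∑ i, z i ^ 2) / c) = (π * c) ^ ((d : ℝ) / 2) := by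
  simp only [exp_neg_sum_sq_div]
  rw [integral_fintype_prod_volume_eq_prod (fun (_ : Fin d) x => Real.exp (-c⁻¹ * x ^ 2))]
  simp only [integral_gaussian, div_inv_eq_mul, Finset.prod_const, Finset.card_univ,
    Fintype.card_fin]
  rw [Real.sqrt_eq_rpow, ← Real.rpow_mul_natCast (by positivity)]
  congr 1
  ring

variable {w : ℝ → ℝ} {b k : ℝ}

theorem integral_mul_gaussian (hb : 0 < b) (hk : 0 < k) (u : ℝ) {t : ℝ} (ht : 0 < t) :
    ∫ z : Fin d → ℝ, u * (4 * π * t * b) ^ (-(d : ℝ) / 2) *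
      Real.exp (-(∑ i, z i ^ 2) / (4 * t * b * k)) = u * k ^ ((d : ℝ) / 2) := by
  rw [integral_const_mul, integral_exp_neg_sum_sq_div (by positivity),
    show π * (4 * t * b * k) = 4 * π * t * b * k by ring,
    Real.mul_rpow (by positivity) hk.le, neg_div, Real.rpow_neg (by positivity)]
  have : (4 * π * t * b) ^ ((d : ℝ) / 2) ≠ 0 := by positivity
  field_simp

theorem integrable_prod_mul_gaussian (hw : IntegrableOn w (Set.Ioi 0)) (hb : 0 < b) (hk : 0 < k) :
    Integrable (fun p : ℝ × (Fin d → ℝ) => w p.1 * (4 * π * p.1 * b) ^ (-(d : ℝ) / 2) *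
      Real.exp (-(∑ i, p.2 i ^ 2) / (4 * p.1 * b * k)))
      ((volume.restrict (Set.Ioi (0 : ℝ))).prod volume) := by
  refine (integrable_prod_iff ?_).2 ⟨?_, ?_⟩
  · refine (hw.aestronglyMeasurable.comp_fst.mul ?_).mul ?_
    · exact Measurable.aestronglyMeasurable (by fun_prop)
    · exact Measurable.aestronglyMeasurable (by fun_prop)
  · filter_upwards [ae_restrict_mem measurableSet_Ioi] with t ht
    have ht : 0 < t := ht
    exact (integrable_exp_neg_sum_sq_div (by positivity)).const_mul _
  · refine (hw.norm.mul_const (k ^ ((d : ℝ) / 2))).congr ?_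
    filter_upwards [ae_restrict_mem measurableSet_Ioi] with t ht
    have ht : 0 < t := ht
    rw [← integral_mul_gaussian hb hk _ ht]
    refine integral_congr_ae (ae_of_all _ fun z => ?_)
    simp only [norm_mul, Real.norm_of_nonneg (Real.exp_nonneg _)]
    rw [Real.norm_of_nonneg (r := _ ^ _) (by positivity)]

theorem integral_prod_mul_gaussian (hw : IntegrableOn w (Set.Ioi 0)) (hb : 0 < b) (hk : 0 < k) :
    ∫ p : ℝ × (Fin d → ℝ), w p.1 * (4 * π * p.1 * b) ^ (-(d : ℝ) / 2) *
      Real.exp (-(∑ i, p.2 i ^ 2) / (4 * p.1 * b * k))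
      ∂(volume.restrict (Set.Ioi (0 : ℝ))).prod volume
      = (∫ t in Set.Ioi 0, w t) * k ^ ((d : ℝ) / 2) := by
  rw [integral_prod _ (integrable_prod_mul_gaussian hw hb hk), ← integral_mul_const]
  refine integral_congr_ae ?_
  filter_upwards [ae_restrict_mem measurableSet_Ioi] with t ht
  exact integral_mul_gaussian hb hk _ ht

/-- The heat kernel at time `b t`, weighted by the density `e^{-t}`. -/
noncomputable def expHeatKernel (d : ℕ) (b t : ℝ) (z : Fin d → ℝ) : ℝ :=
  Real.exp (-t) * (4 * π * t * b) ^ (-(d : ℝ) / 2) * Real.exp (-(∑ i, z i ^ 2) / (4 * t * b))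

/-- The derivative of `expHeatKernel` in the space variable. -/
noncomputable def expHeatKernelDeriv (d : ℕ) (b t : ℝ) (z : Fin d → ℝ) : (Fin d → ℝ) →L[ℝ] ℝ :=
  (-(2 / (4 * t * b)) * expHeatKernel d b t z) • ∑ i, z i • ContinuousLinearMap.proj (R := ℝ) i

theorem measurable_expHeatKernel (b : ℝ) :
    Measurable (Function.uncurry (expHeatKernel d b)) := by
  unfold expHeatKernel Function.uncurry
  fun_prop

theorem stronglyMeasurable_expHeatKernelDeriv (b : ℝ) :
    StronglyMeasurable (Function.uncurry (expHeatKernelDeriv d b)) := by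
  refine StronglyMeasurable.smul (f := fun p : ℝ × (Fin d → ℝ) =>
    -(2 / (4 * p.1 * b)) * Function.uncurry (expHeatKernel d b) p) ?_ ?_
  · have := measurable_expHeatKernel (d := d) b
    exact Measurable.stronglyMeasurable (by fun_prop)
  · exact Continuous.stronglyMeasurable (by fun_prop)

theorem hasFDerivAt_expHeatKernel (b t : ℝ) (z : Fin d → ℝ) :
    HasFDerivAt (expHeatKernel d b t) (expHeatKernelDeriv d b t z) z := by
  have h1 : HasFDerivAt (fun z : Fin d → ℝ => ∑ i, z i ^ 2)
      (∑ i, (2 * z i) • ContinuousLinearMap.proj (R := ℝ) (φ := fun _ : Fin d => ℝ) i) z := by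
    refine HasFDerivAt.fun_sum fun i _ => ?_
    simpa using ((ContinuousLinearMap.proj (R := ℝ) (φ := fun _ : Fin d => ℝ) i).hasFDerivAt
      (x := z)).pow 2
  have h2 := ((h1.neg.mul_const (4 * t * b)⁻¹).exp).const_mul
    (Real.exp (-t) * (4 * π * t * b) ^ (-(d : ℝ) / 2))
  refine h2.congr_fderiv ?_
  ext v
  simp only [expHeatKernelDeriv, expHeatKernel, div_eq_mul_inv, smul_apply, smul_eq_mul,
    sum_apply, ContinuousLinearMap.proj_apply, neg_apply, Pi.neg_apply,
    mul_assoc, ← Finset.mul_sum]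
  ring

theorem continuous_expHeatKernelDeriv (b t : ℝ) : Continuous (expHeatKernelDeriv d b t) := by
  unfold expHeatKernelDeriv expHeatKernel
  fun_prop

theorem integrableOn_exp_neg : IntegrableOn (fun t : ℝ => Real.exp (-t)) (Set.Ioi 0) := by
  simpa using Real.GammaIntegral_convergent one_pos

theorem integrable_expHeatKernel (hb : 0 < b) :
    Integrable (Function.uncurry (expHeatKernel d b))
      ((volume.restrict (Set.Ioi (0 : ℝ))).prod volume) := by
  simpa [Function.uncurry_def, expHeatKernel] using
    integrable_prod_mul_gaussian (d := d) integrableOn_exp_neg hb one_pos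

theorem integral_expHeatKernel (hb : 0 < b) :
    ∫ p, Function.uncurry (expHeatKernel d b) p
      ∂(volume.restrict (Set.Ioi (0 : ℝ))).prod volume = 1 := by
  have := integral_prod_mul_gaussian (d := d) integrableOn_exp_neg hb one_pos
  simp only [mul_one, Real.one_rpow, integral_exp_neg_Ioi_zero] at this
  simpa [Function.uncurry_def, expHeatKernel] using this

theorem mul_exp_neg_sq_le {c : ℝ} (hc : 0 < c) {x S : ℝ} (hx : x ^ 2 ≤ S) :
    2 / c * |x| * Real.exp (-S / c) ≤ 2 / √c * Real.exp (-S / (c * 2)) := by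
  have hs : 0 < √c := Real.sqrt_pos.2 hc
  have hsc : √c ^ 2 = c := Real.sq_sqrt hc.le
  have h1 : |x| / √c ≤ Real.exp (S / (c * 2)) := by
    have hq : (|x| / √c) ^ 2 ≤ S / c := by
      rw [div_pow, hsc, sq_abs]
      gcongr
    have := Real.add_one_le_exp (S / (c * 2))
    have h2 : S / (c * 2) = S / c / 2 := by field_simp
    nlinarith [sq_nonneg (|x| / √c - 1)]
  have h3 : Real.exp (-S / c) = Real.exp (-S / (c * 2)) * (Real.exp (S / (c * 2)))⁻¹ := by
    rw [← Real.exp_neg, ← Real.exp_add]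
    congr 1
    field_simp
    ring
  have h4 : 2 / c * |x| = 2 / √c * (|x| / √c) := by
    rw [div_mul_div_comm, ← sq, hsc]
    ring
  rw [h3, h4]
  calc _ = 2 / √c * Real.exp (-S / (c * 2)) * (|x| / √c * (Real.exp (S / (c * 2)))⁻¹) := by ring
    _ ≤ 2 / √c * Real.exp (-S / (c * 2)) * 1 := by
      gcongr
      rw [← div_eq_mul_inv]
      exact (div_le_one (Real.exp_pos _)).2 h1
    _ = _ := mul_one _

theorem norm_expHeatKernelDeriv_le (hb : 0 < b) {t : ℝ} (ht : 0 < t) (z : Fin d → ℝ) :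
    ‖expHeatKernelDeriv d b t z‖ ≤ d * b ^ (-(1 / 2) : ℝ) *
      (Real.exp (-t) * t ^ ((1 / 2 : ℝ) - 1) * (4 * π * t * b) ^ (-(d : ℝ) / 2) *
        Real.exp (-(∑ i, z i ^ 2) / (4 * t * b * 2))) := by
  have hc : 0 < 4 * t * b := by positivity
  have hsq : 2 / √(4 * t * b) = b ^ (-(1 / 2) : ℝ) * t ^ ((1 / 2 : ℝ) - 1) := by
    rw [Real.sqrt_mul (by positivity), Real.sqrt_mul (by positivity), Real.rpow_neg hb.le,
      show (1 / 2 : ℝ) - 1 = -(1 / 2) by norm_num, Real.rpow_neg ht.le, ← Real.sqrt_eq_rpow,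
      ← Real.sqrt_eq_rpow, show (4 : ℝ) = 2 ^ 2 by norm_num, Real.sqrt_sq (by norm_num)]
    field_simp
  have hproj (i : Fin d) :
      ‖z i • ContinuousLinearMap.proj (R := ℝ) (φ := fun _ : Fin d => ℝ) i‖ ≤ |z i| := by
    rw [norm_smul, Real.norm_eq_abs]
    refine mul_le_of_le_one_right (abs_nonneg _) ?_
    exact ContinuousLinearMap.opNorm_le_bound _ zero_le_one fun v => by
      simpa using norm_le_pi_norm v i
  set A := Real.exp (-t) * (4 * π * t * b) ^ (-(d : ℝ) / 2) with hA
  have hA0 : 0 ≤ A := by positivity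
  have hG : expHeatKernel d b t z = A * Real.exp (-(∑ i, z i ^ 2) / (4 * t * b)) := rfl
  rw [expHeatKernelDeriv, norm_smul, neg_mul, norm_neg, hG, Real.norm_of_nonneg (by positivity)]
  calc _ ≤ 2 / (4 * t * b) * (A * Real.exp (-(∑ i, z i ^ 2) / (4 * t * b))) * ∑ i, |z i| := by
        gcongr
        exact (norm_sum_le _ _).trans (Finset.sum_le_sum fun i _ => hproj i)
    _ = ∑ i, A * (2 / (4 * t * b) * |z i| * Real.exp (-(∑ i, z i ^ 2) / (4 * t * b))) := by
        rw [Finset.mul_sum]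
        exact Finset.sum_congr rfl fun i _ => by ring
    _ ≤ ∑ _ : Fin d, A * (2 / √(4 * t * b) * Real.exp (-(∑ i, z i ^ 2) / (4 * t * b * 2))) := by
        refine Finset.sum_le_sum fun i _ => mul_le_mul_of_nonneg_left (mul_exp_neg_sq_le hc ?_) hA0
        exact Finset.single_le_sum (f := fun i => z i ^ 2) (fun j _ => sq_nonneg _)
          (Finset.mem_univ i)
    _ = _ := by
        rw [hsq, Finset.sum_const, Finset.card_univ, Fintype.card_fin, nsmul_eq_mul, hA]
        ring

theorem integrable_expHeatKernelDeriv (hb : 0 < b) :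
    Integrable (Function.uncurry (expHeatKernelDeriv d b))
      ((volume.restrict (Set.Ioi (0 : ℝ))).prod volume) := by
  refine ((integrable_prod_mul_gaussian (d := d) (Real.GammaIntegral_convergent
    (s := 1 / 2) (by norm_num)) hb two_pos).const_mul (d * b ^ (-(1 / 2) : ℝ))).mono'
    (stronglyMeasurable_expHeatKernelDeriv b).aestronglyMeasurable ?_
  filter_upwards [Measure.quasiMeasurePreserving_fst.ae (ae_restrict_mem measurableSet_Ioi)]
    with p hp
  exact norm_expHeatKernelDeriv_le hb hp p.2

theorem integral_norm_expHeatKernelDeriv_le (hb : 0 < b) :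
    ∫ p, ‖Function.uncurry (expHeatKernelDeriv d b) p‖
      ∂(volume.restrict (Set.Ioi (0 : ℝ))).prod volume
      ≤ d * b ^ (-(1 / 2) : ℝ) * (Real.Gamma (1 / 2) * 2 ^ ((d : ℝ) / 2)) := by
  have hw := Real.GammaIntegral_convergent (s := 1 / 2) (by norm_num)
  rw [Real.Gamma_eq_integral (by norm_num), ← integral_prod_mul_gaussian hw hb two_pos,
    ← integral_const_mul]
  refine integral_mono_ae (integrable_expHeatKernelDeriv hb).norm
    ((integrable_prod_mul_gaussian hw hb two_pos).const_mul _) ?_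
  filter_upwards [Measure.quasiMeasurePreserving_fst.ae (ae_restrict_mem measurableSet_Ioi)]
    with p hp
  exact norm_expHeatKernelDeriv_le hb hp p.2

end Gaussian

section KernelMeasure

variable {d : ℕ} {σ μ : ℝ}

theorem Kmeas_eq_map_withDensity (d : ℕ) (σ μ : ℝ) :
    Kmeas d σ μ = (((volume.restrict (Set.Ioi (0 : ℝ))).prod volume).withDensity
      fun p => ENNReal.ofReal (Function.uncurry (expHeatKernel d (μ ^ ((2 : ℝ) / σ))) p)).map
        Prod.snd := by
  ext A hA
  have hm := (measurable_expHeatKernel (d := d) (μ ^ ((2 : ℝ) / σ))).ennreal_ofReal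
  rw [Measure.map_apply measurable_snd hA, withDensity_apply _ (measurable_snd hA), Kmeas,
    withDensity_apply _ hA, ← Set.univ_prod, ← Measure.prod_restrict, Measure.restrict_univ,
    lintegral_prod_symm _ hm.aemeasurable]
  rfl

theorem isProbabilityMeasure_Kmeas (hμ : 0 < μ) : IsProbabilityMeasure (Kmeas d σ μ) := by
  have hb : 0 < μ ^ ((2 : ℝ) / σ) := Real.rpow_pos_of_pos hμ _
  constructor
  rw [Kmeas_eq_map_withDensity, Measure.map_apply measurable_snd MeasurableSet.univ,
    Set.preimage_univ, withDensity_apply _ MeasurableSet.univ, Measure.restrict_univ,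
    ← ofReal_integral_eq_lintegral_ofReal (integrable_expHeatKernel hb), integral_expHeatKernel hb,
    ENNReal.ofReal_one]
  filter_upwards [Measure.quasiMeasurePreserving_fst.ae (ae_restrict_mem measurableSet_Ioi)]
    with p hp
  have hp : 0 < p.1 := hp
  simp only [Function.uncurry, expHeatKernel, Pi.zero_apply]
  positivity

theorem measConv_Kmeas (hμ : 0 < μ) {f : (Fin d → ℝ) → ℝ} (hf : Continuous f) :
    measConv d (Kmeas d σ μ) f = fun x => ∫ p, f (x - p.2) • expHeatKernel d (μ ^ ((2 : ℝ) / σ))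
      p.1 p.2 ∂(volume.restrict (Set.Ioi (0 : ℝ))).prod volume := by
  have hb : 0 < μ ^ ((2 : ℝ) / σ) := Real.rpow_pos_of_pos hμ _
  have hm := measurable_expHeatKernel (d := d) (μ ^ ((2 : ℝ) / σ))
  ext x
  rw [measConv, Kmeas_eq_map_withDensity, integral_map measurable_snd.aemeasurable
    (Continuous.aestronglyMeasurable (by fun_prop)),
    integral_withDensity_eq_integral_toReal_smul hm.ennreal_ofReal
      (ae_of_all _ fun _ => ENNReal.ofReal_lt_top)]
  refine integral_congr_ae ?_
  filter_upwards [Measure.quasiMeasurePreserving_fst.ae (ae_restrict_mem measurableSet_Ioi)]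
    with p hp
  have hp : 0 < p.1 := hp
  have : 0 ≤ Function.uncurry (expHeatKernel d (μ ^ ((2 : ℝ) / σ))) p := by
    simp only [Function.uncurry, expHeatKernel]
    positivity
  rw [ENNReal.toReal_ofReal this, smul_eq_mul, smul_eq_mul, mul_comm]
  rfl

theorem hasFDerivAt_measConv_Kmeas (hμ : 0 < μ) {f : (Fin d → ℝ) → ℝ} (hf : Continuous f)
    {M : ℝ} (hfM : ∀ x, ‖f x‖ ≤ M) (x : Fin d → ℝ) :
    HasFDerivAt (measConv d (Kmeas d σ μ) f)
      (∫ p, f (x - p.2) • expHeatKernelDeriv d (μ ^ ((2 : ℝ) / σ)) p.1 p.2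
        ∂(volume.restrict (Set.Ioi (0 : ℝ))).prod volume) x := by
  have hb : 0 < μ ^ ((2 : ℝ) / σ) := Real.rpow_pos_of_pos hμ _
  rw [measConv_Kmeas hμ hf]
  exact hasFDerivAt_integral_kernel hf hfM (hasFDerivAt_expHeatKernel _)
    (continuous_expHeatKernelDeriv _) (integrable_expHeatKernel hb)
    (stronglyMeasurable_expHeatKernelDeriv _) (integrable_expHeatKernelDeriv hb) x

theorem contDiff_one_measConv_Kmeas (hμ : 0 < μ) {f : (Fin d → ℝ) → ℝ} (hf : Continuous f)
    {M : ℝ} (hfM : ∀ x, ‖f x‖ ≤ M) : ContDiff ℝ 1 (measConv d (Kmeas d σ μ) f) := by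
  have hb : 0 < μ ^ ((2 : ℝ) / σ) := Real.rpow_pos_of_pos hμ _
  refine contDiff_one_iff_fderiv.2
    ⟨fun x => (hasFDerivAt_measConv_Kmeas hμ hf hfM x).differentiableAt, ?_⟩
  rw [show fderiv ℝ (measConv d (Kmeas d σ μ) f) = _ from
    funext fun x => (hasFDerivAt_measConv_Kmeas hμ hf hfM x).fderiv]
  exact continuous_integral_smul_kernel hf hfM (integrable_expHeatKernelDeriv hb)

theorem norm_pder_measConv_Kmeas_le (hμ : 0 < μ) {f : (Fin d → ℝ) → ℝ} (hf : Continuous f)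
    {M : ℝ} (hfM : ∀ x, ‖f x‖ ≤ M) (i : Fin d) (x : Fin d → ℝ) :
    ‖pder d i (measConv d (Kmeas d σ μ) f) x‖ ≤
      d * (Real.Gamma (1 / 2) * 2 ^ ((d : ℝ) / 2)) * μ ^ (-1 / σ) * M := by
  have hb : 0 < μ ^ ((2 : ℝ) / σ) := Real.rpow_pos_of_pos hμ _
  have hM : 0 ≤ M := (norm_nonneg _).trans (hfM 0)
  rw [pder, (hasFDerivAt_measConv_Kmeas hμ hf hfM x).fderiv]
  refine (ContinuousLinearMap.le_opNorm _ _).trans ?_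
  rw [Pi.norm_single, norm_one, mul_one]
  have hpow : (μ ^ ((2 : ℝ) / σ)) ^ (-(1 / 2) : ℝ) = μ ^ (-1 / σ) := by
    rw [← Real.rpow_mul hμ.le]
    congr 1
    ring
  calc _ ≤ ∫ p, M * ‖Function.uncurry (expHeatKernelDeriv d (μ ^ ((2 : ℝ) / σ))) p‖
        ∂(volume.restrict (Set.Ioi (0 : ℝ))).prod volume := by
        refine norm_integral_le_of_norm_le ((integrable_expHeatKernelDeriv hb).norm.const_mul M)
          (ae_of_all _ fun p => ?_)
        rw [norm_smul]
        exact mul_le_mul_of_nonneg_right (hfM _) (norm_nonneg _)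
    _ ≤ M * (d * (μ ^ ((2 : ℝ) / σ)) ^ (-(1 / 2) : ℝ) *
          (Real.Gamma (1 / 2) * 2 ^ ((d : ℝ) / 2))) := by
        rw [integral_const_mul]
        exact mul_le_mul_of_nonneg_left (integral_norm_expHeatKernelDeriv_le hb) hM
    _ = _ := by rw [hpow]; ring

theorem norm_measConv_le {κ : Measure (Fin d → ℝ)} [IsProbabilityMeasure κ]
    {f : (Fin d → ℝ) → ℝ} {M : ℝ} (hfM : ∀ x, ‖f x‖ ≤ M) (x : Fin d → ℝ) :
    ‖measConv d κ f x‖ ≤ M := by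
  simpa [measConv] using norm_integral_le_of_norm_le_const (μ := κ) (ae_of_all _ fun z => hfM (x - z))

theorem isProbabilityMeasure_Kpow (hμ : 0 < μ) (g : ℕ) :
    IsProbabilityMeasure (Kpow d σ μ g) := by
  induction g with
  | zero => exact Measure.dirac.isProbabilityMeasure
  | succ g ih =>
    have := isProbabilityMeasure_Kmeas (d := d) (σ := σ) hμ
    rw [Kpow]
    infer_instance

theorem measConv_conv {κ ρ : Measure (Fin d → ℝ)} [IsProbabilityMeasure κ]
    [IsProbabilityMeasure ρ] {f : (Fin d → ℝ) → ℝ} (hf : Continuous f) {M : ℝ}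
    (hfM : ∀ x, ‖f x‖ ≤ M) : measConv d (κ.conv ρ) f = measConv d κ (measConv d ρ f) := by
  ext x
  have hi : Integrable (fun z => f (x - z)) (κ.conv ρ) :=
    Integrable.of_bound (Continuous.aestronglyMeasurable (by fun_prop)) M
      (ae_of_all _ fun _ => hfM _)
  simp only [measConv]
  rw [integral_conv hi]
  simp only [sub_sub]

theorem measConv_dirac_zero (f : (Fin d → ℝ) → ℝ) : measConv d (Measure.dirac 0) f = f := by
  ext x
  simp [measConv]

end KernelMeasure

section PartialDerivatives

variable {d : ℕ}

theorem contDiff_pder {n : WithTop ℕ∞} {f : (Fin d → ℝ) → ℝ} (hf : ContDiff ℝ (n + 1) f)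
    (i : Fin d) : ContDiff ℝ n (pder d i f) :=
  (contDiff_succ_iff_fderiv_apply.1 hf).2.2 _

theorem contDiff_succ_of_pder {n : ℕ} {f : (Fin d → ℝ) → ℝ} (hf : Differentiable ℝ f)
    (h : ∀ i, ContDiff ℝ n (pder d i f)) : ContDiff ℝ (n + 1) f := by
  refine contDiff_succ_iff_fderiv_apply.2 ⟨hf, by simp, fun y => ?_⟩
  have (x : Fin d → ℝ) : fderiv ℝ f x y = ∑ i, y i * pder d i f x := by
    conv_lhs => rw [pi_eq_sum_univ' y, map_sum]
    simp [pder]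
  simp only [this]
  exact ContDiff.sum fun i _ => contDiff_const.mul (h i)

theorem contDiff_foldr_pder {n : ℕ} {f : (Fin d → ℝ) → ℝ} (l : List (Fin d))
    (hf : ContDiff ℝ (n + l.length : ℕ) f) : ContDiff ℝ n (l.foldr (pder d) f) := by
  induction l generalizing n with
  | nil => exact hf
  | cons i l ih =>
    refine contDiff_pder ?_ i
    have := ih (n := n + 1) (by convert hf using 2; simp; ring)
    exact_mod_cast this

theorem foldr_iterate_pder (L : List (Fin d)) (a : Fin d → ℕ) (f : (Fin d → ℝ) → ℝ) :
    L.foldr (fun i g => (pder d i)^[a i] g) f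
      = (L.flatMap fun i => List.replicate (a i) i).foldr (pder d) f := by
  have hrep (n : ℕ) (i : Fin d) (h : (Fin d → ℝ) → ℝ) :
      (List.replicate n i).foldr (pder d) h = (pder d i)^[n] h := by
    induction n with
    | zero => rfl
    | succ n ih => rw [List.replicate_succ, List.foldr_cons, ih, Function.iterate_succ_apply']
  induction L with
  | nil => rfl
  | cons i L ih => rw [List.foldr_cons, List.flatMap_cons, List.foldr_append, hrep, ih]

theorem pder_measConv {κ : Measure (Fin d → ℝ)} [IsFiniteMeasure κ] {f : (Fin d → ℝ) → ℝ}
    (hf : ContDiff ℝ 1 f) {M : ℝ} (hfM : ∀ x, ‖f x‖ ≤ M) (i : Fin d) {M' : ℝ}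
    (hfM' : ∀ x, ‖pder d i f x‖ ≤ M') (hd : Differentiable ℝ (measConv d κ f)) :
    pder d i (measConv d κ f) = measConv d κ (pder d i f) := by
  ext x
  have hfc : Continuous f := hf.continuous
  have hpc : Continuous (pder d i f) := (contDiff_pder (n := 0) (by simpa using hf) i).continuous
  have hline (y : Fin d → ℝ) (r : ℝ) :
      HasDerivAt (fun r : ℝ => y + r • (Pi.single i 1 : Fin d → ℝ)) (Pi.single i 1) r := by
    simpa using ((hasDerivAt_id r).smul_const (Pi.single i 1 : Fin d → ℝ)).const_add y
  have h1 : HasDerivAt (fun r : ℝ => measConv d κ f (x + r • Pi.single i 1))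
      (pder d i (measConv d κ f) x) 0 := by
    have := (hd (x + (0 : ℝ) • Pi.single i 1)).hasFDerivAt.comp_hasDerivAt (0 : ℝ) (hline x 0)
    simpa [pder, Function.comp_def] using this
  have h2 := (hasDerivAt_integral_of_dominated_loc_of_deriv_le (μ := κ) (x₀ := (0 : ℝ))
    (F := fun (r : ℝ) z => f (x + r • Pi.single i 1 - z))
    (F' := fun (r : ℝ) z => pder d i f (x + r • Pi.single i 1 - z)) (bound := fun _ => M')
    Filter.univ_mem
    (Filter.Eventually.of_forall fun r => Continuous.aestronglyMeasurable (by fun_prop))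
    (Integrable.of_bound (Continuous.aestronglyMeasurable (by fun_prop)) M
      (ae_of_all _ fun _ => hfM _))
    (Continuous.aestronglyMeasurable (by fun_prop))
    (ae_of_all _ fun z r _ => hfM' _) (integrable_const _)
    (ae_of_all _ fun z r _ => by
      exact ((hf.differentiable one_ne_zero) _).hasFDerivAt.comp_hasDerivAt r
        ((hline x r).sub_const z))).2
  simpa [measConv] using h1.unique h2

theorem measConv_smoothing {κ : Measure (Fin d → ℝ)} [IsFiniteMeasure κ]
    (hκ : ∀ f : (Fin d → ℝ) → ℝ, Continuous f → ∀ M : ℝ, (∀ x, ‖f x‖ ≤ M) →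
      ContDiff ℝ 1 (measConv d κ f))
    (n : ℕ) {h : (Fin d → ℝ) → ℝ} (hh : ContDiff ℝ n h)
    (hb : ∀ l : List (Fin d), l.length ≤ n → ∃ M, ∀ x, ‖l.foldr (pder d) h x‖ ≤ M) :
    ContDiff ℝ (n + 1) (measConv d κ h) ∧ ∀ l : List (Fin d), l.length ≤ n →
      l.foldr (pder d) (measConv d κ h) = measConv d κ (l.foldr (pder d) h) := by
  induction n generalizing h with
  | zero =>
    obtain ⟨M, hM⟩ := hb [] le_rfl
    refine ⟨by simpa using hκ h hh.continuous M hM, fun l hl => ?_⟩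
    rw [List.length_eq_zero_iff.1 (Nat.le_zero.1 hl)]
    rfl
  | succ n ih =>
    obtain ⟨M, hM⟩ := hb [] (Nat.zero_le _)
    have hd : Differentiable ℝ (measConv d κ h) :=
      (hκ h hh.continuous M hM).differentiable one_ne_zero
    have hcomm (i : Fin d) : pder d i (measConv d κ h) = measConv d κ (pder d i h) := by
      obtain ⟨M', hM'⟩ := hb [i] (by simp)
      exact pder_measConv (hh.of_le (by simp)) hM i hM' hd
    have hi (i : Fin d) := ih (h := pder d i h) (contDiff_pder (by exact_mod_cast hh) i)
      fun l hl => by simpa using hb (l ++ [i]) (by simpa using hl)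
    constructor
    · exact contDiff_succ_of_pder hd fun i => by
        rw [hcomm]
        exact_mod_cast (hi i).1
    · intro l hl
      rcases l.eq_nil_or_concat with rfl | ⟨l, i, rfl⟩
      · rfl
      · simpa [hcomm] using (hi i).2 l (by simpa using hl)

end PartialDerivatives

theorem contDiff_and_bound_measConv_Kpow {d : ℕ} {σ μ : ℝ} (hμ : 0 < μ) (g : ℕ)
    {f : (Fin d → ℝ) → ℝ} (hf : Continuous f) {M : ℝ} (hfM : ∀ x, ‖f x‖ ≤ M) :
    ContDiff ℝ g (measConv d (Kpow d σ μ g) f) ∧ ∀ l : List (Fin d), l.length ≤ g → ∀ x,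
      ‖l.foldr (pder d) (measConv d (Kpow d σ μ g) f) x‖ ≤
        (d * (Real.Gamma (1 / 2) * 2 ^ ((d : ℝ) / 2)) * μ ^ (-1 / σ)) ^ l.length * M := by
  induction g with
  | zero =>
    rw [Kpow, measConv_dirac_zero]
    refine ⟨by simpa using hf, fun l hl => ?_⟩
    rw [List.length_eq_zero_iff.1 (Nat.le_zero.1 hl)]
    simpa using hfM
  | succ g ih =>
    have := isProbabilityMeasure_Kmeas (d := d) (σ := σ) hμ
    have := isProbabilityMeasure_Kpow (d := d) (σ := σ) hμ g
    rw [Kpow, measConv_conv hf hfM]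
    obtain ⟨hsmooth, hbound⟩ := ih
    obtain ⟨hsmooth', hcomm⟩ := measConv_smoothing (κ := Kmeas d σ μ)
      (fun f hf M hM => contDiff_one_measConv_Kmeas hμ hf hM) g hsmooth
      fun l hl => ⟨_, hbound l hl⟩
    refine ⟨by exact_mod_cast hsmooth', fun l hl x => ?_⟩
    cases l with
    | nil => simpa using norm_measConv_le (norm_measConv_le hfM) x
    | cons i l =>
      have hl : l.length ≤ g := by simpa using hl
      rw [List.foldr_cons, hcomm l hl, List.length_cons, pow_succ', mul_assoc _ _ M]
      refine norm_pder_measConv_Kmeas_le hμ ?_ (hbound l hl) i x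
      exact (contDiff_foldr_pder (n := 0) l (hsmooth.of_le (by simpa using hl))).continuous

/-- for `g ≥ 1`, `|a| ≤ g` there is `C = C(d,σ,g,a) > 0` such that for all
bounded continuous `f` and `μ > 0`, `K_μ^{*g} ∗ f` is `|a|`-times continuously
differentiable, `∂^a(K_μ^{*g} ∗ f)` is continuous and
`‖∂^a(K_μ^{*g} ∗ f)‖_{L^∞} ≤ C [μ]^{−|a|} ‖f‖_{L^∞}`. -/
theorem stmt9 (d : ℕ) (hd : 1 ≤ d) (σ : ℝ) (hσ : 0 < σ) (g : ℕ) (hg : 1 ≤ g)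
    (a : Fin d → ℕ) (ha : ∑ i, a i ≤ g) :
    ∃ C : ℝ, 0 < C ∧ ∀ f : (Fin d → ℝ) → ℝ, Continuous f → ∀ M : ℝ, (∀ x, ‖f x‖ ≤ M) →
      ∀ μ : ℝ, 0 < μ →
        ContDiff ℝ (∑ i, a i) (measConv d (Kpow d σ μ g) f) ∧
        Continuous (mpder d a (measConv d (Kpow d σ μ g) f)) ∧
        ∀ x, ‖mpder d a (measConv d (Kpow d σ μ g) f) x‖ ≤
          C * μ ^ (-((∑ i, a i : ℕ) : ℝ) / σ) * M := by
  have hC : 0 < (d : ℝ) * (Real.Gamma (1 / 2) * 2 ^ ((d : ℝ) / 2)) := by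
    have : 0 < Real.Gamma (1 / 2) := Real.Gamma_pos_of_pos (by norm_num)
    have : (0 : ℝ) < d := by exact_mod_cast hd
    positivity
  refine ⟨_, pow_pos hC (∑ i, a i), fun f hf M hfM μ hμ => ?_⟩
  obtain ⟨hsmooth, hbound⟩ := contDiff_and_bound_measConv_Kpow (σ := σ) hμ g hf hfM
  have hlen : ((List.finRange d).flatMap fun i => List.replicate (a i) i).length = ∑ i, a i := by
    simp [List.length_flatMap, Fin.sum_univ_def]
  have hsmooth' : ContDiff ℝ (∑ i, a i : ℕ) (measConv d (Kpow d σ μ g) f) :=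
    hsmooth.of_le (by exact_mod_cast ha)
  rw [mpder, foldr_iterate_pder]
  refine ⟨by exact_mod_cast hsmooth', ?_, fun x => ?_⟩
  · exact (contDiff_foldr_pder (n := 0) _ (by rwa [hlen, zero_add])).continuous
  · refine (hbound _ (hlen.trans_le ha) x).trans_eq ?_
    rw [hlen, mul_pow, ← Real.rpow_mul_natCast hμ.le]
    congr 3
    ring
end

section
/- Fix n ∈ ℕ₊, σ > 0 and ε ∈ (0, σ), and write [κ] := κ^{1/σ}. There exists a constant c > 0, depending only on n, σ, ε, with the following property. Let (Ω, ℱ, ℙ) be a probability space and let ζ : (0,1]^2 × Ω → L^∞(𝕋), (κ, μ, ω) ↦ ζ_{κ,μ}(ω), be a random function such that for each ω the map (κ,μ) ↦ ζ_{κ,μ} is continuously differentiable with a continuous mixed partial derivative ∂_μ∂_κ ζ_{κ,μ}, and such that the relevant suprema and norms are measurable in ω. Suppose there exist C > 0 and ω₀, ρ ≤ 0 such that for all u, s ∈ {0,1} and all κ, μ ∈ (0,1]: 𝔼 ‖∂_μ^s ∂_κ^u ζ_{κ,μ}‖_{L^∞(𝕋)}^n ≤ C [κ]^{−n(ω₀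 + σu − εu)} [μ]^{−n(ρ + σs − εs)}. Then 𝔼 ( sup_{κ,μ ∈ (0,1]} [κ]^{nω₀} [μ]^{nρ} ‖ζ_{κ,μ}‖_{L^∞(𝕋)}^n ) ≤ c C. -/
open MeasureTheory ENNReal Real

/-- The measure `x ^ (δ - 1) dx` on `(0, 1]`. -/
noncomputable def powerMeasure (δ : ℝ) : Measure ℝ :=
  (volume.restrict (Set.Ioc 0 1)).withDensity fun x => ENNReal.ofReal (x ^ (δ - 1))

lemma powerMeasure_univ {δ : ℝ} (hδ : 0 < δ) :
    powerMeasure δ Set.univ = ENNReal.ofReal (1 / δ) := by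
  have hi : IntervalIntegrable (fun x : ℝ => x ^ (δ - 1)) volume 0 1 :=
    intervalIntegral.intervalIntegrable_rpow' (by linarith)
  rw [powerMeasure, withDensity_apply _ MeasurableSet.univ, Measure.restrict_univ,
    ← ofReal_integral_eq_lintegral_ofReal
      ((intervalIntegrable_iff_integrableOn_Ioc_of_le zero_le_one).1 hi)
      ((ae_restrict_iff' measurableSet_Ioc).2 (.of_forall fun x hx => rpow_nonneg hx.1.le _)),
    ← intervalIntegral.integral_of_le zero_le_one, integral_rpow (Or.inl (by linarith)),
    sub_add_cancel, Real.one_rpow, Real.zero_rpow hδ.ne', sub_zero]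

instance (δ : ℝ) : SFinite (powerMeasure δ) := by
  unfold powerMeasure; infer_instance

/-- The projection of the real line onto `[τ, 1]`. -/
def clampUnit (τ x : ℝ) : ℝ := max τ (min x 1)

lemma clampUnit_mem {τ : ℝ} (hτ : τ ≤ 1) (x : ℝ) : clampUnit τ x ∈ Set.Icc τ 1 :=
  ⟨le_max_left _ _, max_le hτ (min_le_right _ _)⟩

lemma clampUnit_of_mem {τ x : ℝ} (hx : x ∈ Set.Icc τ 1) : clampUnit τ x = x := by
  simp [clampUnit, hx.1, hx.2]

lemma continuous_clampUnit (τ : ℝ) : Continuous (clampUnit τ) := by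
  unfold clampUnit; fun_prop

lemma measurable_ofReal_clampUnit_rpow (τ e : ℝ) :
    Measurable fun x => ENNReal.ofReal (clampUnit τ x ^ e) :=
  ((continuous_clampUnit τ).measurable.pow_const e).ennreal_ofReal

section Jensen

variable {X Ω : Type*} [MeasurableSpace X] [MeasurableSpace Ω]

lemma lintegral_pow_le (m : Measure X) {f : X → ℝ≥0∞} (hf : Measurable f) {n : ℕ} (hn : 0 < n) :
    (∫⁻ x, f x ∂m) ^ n ≤ m Set.univ ^ (n - 1) * ∫⁻ x, f x ^ n ∂m := by
  have hn' : (n : ℝ) ≠ 0 := by positivity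
  have h := eLpNorm_le_eLpNorm_mul_rpow_measure_univ (μ := m) (p := 1) (q := n)
    (by exact_mod_cast hn) hf.aestronglyMeasurable
  rw [eLpNorm_one_eq_lintegral_enorm, eLpNorm_eq_lintegral_rpow_enorm_toReal
    (by exact_mod_cast hn.ne') (ENNReal.natCast_ne_top n)] at h
  simp only [enorm_eq_self, toReal_natCast, toReal_one, ENNReal.rpow_natCast] at h
  refine (pow_le_pow_left' h n).trans_eq ?_
  rw [mul_pow, ← ENNReal.rpow_natCast, ← ENNReal.rpow_mul, ← ENNReal.rpow_natCast (m _ ^ _),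
    ← ENNReal.rpow_mul, one_div_mul_cancel hn', ENNReal.rpow_one, mul_comm]
  congr 1
  rw [← ENNReal.rpow_natCast]
  congr 1
  rw [Nat.cast_sub hn]
  field_simp
  simp

lemma lintegral_lintegral_pow_le (m : Measure X) [SFinite m] (P : Measure Ω) [SFinite P]
    {f : X → Ω → ℝ≥0∞} (hf : Measurable (Function.uncurry f)) {n : ℕ} (hn : 0 < n) {K : ℝ≥0∞}
    (h : ∀ x, ∫⁻ ω, f x ω ^ n ∂P ≤ K) :
    ∫⁻ ω, (∫⁻ x, f x ω ∂m) ^ n ∂P ≤ m Set.univ ^ n * K := by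
  have hf' : Measurable (Function.uncurry fun ω x => f x ω) := hf.comp measurable_swap
  calc ∫⁻ ω, (∫⁻ x, f x ω ∂m) ^ n ∂P
      ≤ ∫⁻ ω, m Set.univ ^ (n - 1) * ∫⁻ x, f x ω ^ n ∂m ∂P :=
        lintegral_mono fun ω => lintegral_pow_le m (hf.comp measurable_prodMk_right) hn
    _ = m Set.univ ^ (n - 1) * ∫⁻ ω, ∫⁻ x, f x ω ^ n ∂m ∂P :=
        lintegral_const_mul _ (Measurable.lintegral_prod_right (hf'.pow_const n))
    _ = m Set.univ ^ (n - 1) * ∫⁻ x, ∫⁻ ω, f x ω ^ n ∂P ∂m := by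
        rw [lintegral_lintegral_swap (hf'.pow_const n).aemeasurable]
    _ ≤ m Set.univ ^ (n - 1) * ∫⁻ _, K ∂m := by gcongr with x; exact h x
    _ = m Set.univ ^ n * K := by
        rw [lintegral_const, mul_comm K, ← mul_assoc, ← pow_succ, Nat.sub_add_cancel hn]

lemma lintegral_sum_pow_le {ι : Type*} [Fintype ι] (P : Measure Ω) [SFinite P]
    {f : ι → Ω → ℝ≥0∞} (hf : ∀ i, Measurable (f i)) {n : ℕ} (hn : 0 < n) {K : ℝ≥0∞}
    (h : ∀ i, ∫⁻ ω, f i ω ^ n ∂P ≤ K) :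
    ∫⁻ ω, (∑ i, f i ω) ^ n ∂P ≤ (Fintype.card ι : ℝ≥0∞) ^ n * K := by
  let _ : MeasurableSpace ι := ⊤
  have := lintegral_lintegral_pow_le Measure.count P (f := f)
    (measurable_from_prod_countable_right hf) hn h
  simpa [lintegral_count, tsum_fintype, Measure.count_univ] using this

end Jensen

section Deterministic

variable {E : Type*} [NormedAddCommGroup E] [NormedSpace ℝ E] [CompleteSpace E]

lemma enorm_le_add_setLIntegral_deriv {f f' : ℝ → E} {a b : ℝ} (hab : a ≤ b)
    (hf : ∀ x ∈ Set.Icc a b, HasDerivAt f (f' x) x) (hc : ContinuousOn f' (Set.Icc a b)) :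
    ‖f b‖ₑ ≤ ‖f a‖ₑ + ∫⁻ x in Set.Ioc a b, ‖f' x‖ₑ := by
  have h := intervalIntegral.integral_eq_sub_of_hasDerivAt (f := f) (f' := f') (a := a) (b := b)
    (by rwa [Set.uIcc_of_le hab]) (hc.intervalIntegrable_of_Icc hab)
  rw [intervalIntegral.integral_of_le hab] at h
  calc ‖f b‖ₑ = ‖f a + (f b - f a)‖ₑ := by rw [add_sub_cancel]
    _ ≤ ‖f a‖ₑ + ‖f b - f a‖ₑ := enorm_add_le _ _
    _ ≤ _ := by rw [← h]; gcongr; exact enorm_integral_le_lintegral_enorm _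

lemma rpow_mul_enorm_le_add_lintegral {f f' : ℝ → E} {τ a δ κ : ℝ} (hτ : 0 < τ) (ha : a ≤ 0)
    (hf : ∀ x ∈ Set.Icc τ 1, HasDerivAt f (f' x) x) (hc : ContinuousOn f' (Set.Icc τ 1))
    (hκ : κ ∈ Set.Icc τ 1) :
    ENNReal.ofReal (κ ^ a) * ‖f κ‖ₑ ≤ ENNReal.ofReal (τ ^ a) * ‖f τ‖ₑ +
      ∫⁻ x, ENNReal.ofReal (clampUnit τ x ^ (a + 1 - δ)) * ‖f' (clampUnit τ x)‖ₑ
        ∂powerMeasure δ := by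
  have hτ1 : τ ≤ 1 := hκ.1.trans hκ.2
  have hsub : Set.Icc τ κ ⊆ Set.Icc τ 1 := Set.Icc_subset_Icc_right hκ.2
  have hsub' : Set.Ioc τ κ ⊆ Set.Ioc 0 1 := Set.Ioc_subset_Ioc hτ.le hκ.2
  have hcc : Continuous fun x => f' (clampUnit τ x) :=
    hc.comp_continuous (continuous_clampUnit τ) (clampUnit_mem hτ1)
  have hm : Measurable fun x =>
      ENNReal.ofReal (clampUnit τ x ^ (a + 1 - δ)) * ‖f' (clampUnit τ x)‖ₑ :=
    (measurable_ofReal_clampUnit_rpow τ _).mul hcc.enorm.measurable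
  calc ENNReal.ofReal (κ ^ a) * ‖f κ‖ₑ
      ≤ ENNReal.ofReal (κ ^ a) * (‖f τ‖ₑ + ∫⁻ x in Set.Ioc τ κ, ‖f' x‖ₑ) := by
        gcongr
        exact enorm_le_add_setLIntegral_deriv hκ.1 (fun x hx => hf x (hsub hx)) (hc.mono hsub)
    _ = ENNReal.ofReal (κ ^ a) * ‖f τ‖ₑ +
          ∫⁻ x in Set.Ioc τ κ, ENNReal.ofReal (κ ^ a) * ‖f' x‖ₑ := by
        rw [mul_add, lintegral_const_mul' _ _ ENNReal.ofReal_ne_top]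
    _ ≤ ENNReal.ofReal (τ ^ a) * ‖f τ‖ₑ + ∫⁻ x in Set.Ioc τ κ, ENNReal.ofReal (x ^ (δ - 1)) *
          (ENNReal.ofReal (clampUnit τ x ^ (a + 1 - δ)) * ‖f' (clampUnit τ x)‖ₑ) := by
        gcongr ENNReal.ofReal ?_ * _ + ?_
        · exact rpow_le_rpow_of_nonpos hτ hκ.1 ha
        · refine setLIntegral_mono' measurableSet_Ioc fun x hx => ?_
          have hx0 : 0 < x := hτ.trans hx.1
          rw [clampUnit_of_mem (hsub (Set.Ioc_subset_Icc_self hx)), ← mul_assoc,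
            ← ENNReal.ofReal_mul (rpow_nonneg hx0.le _), ← rpow_add hx0]
          gcongr ENNReal.ofReal ?_ * _
          rw [show δ - 1 + (a + 1 - δ) = a by ring]
          exact rpow_le_rpow_of_nonpos hx0 hx.2 ha
    _ ≤ _ := by
        have hw : Measurable fun x : ℝ => ENNReal.ofReal (x ^ (δ - 1)) :=
          (measurable_id.pow_const _).ennreal_ofReal
        rw [powerMeasure, lintegral_withDensity_eq_lintegral_mul _ hw hm]
        exact add_le_add_right (lintegral_mono_set hsub') _

end Deterministic

/-- The norm of `z` at the clamped point, weighted by powers of both clamped coordinates. -/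
noncomputable def clampedWeightedNorm {E : Type*} [NormedAddCommGroup E] (τ e e' : ℝ)
    (z : ℝ → ℝ → E) (x y : ℝ) : ℝ≥0∞ :=
  ENNReal.ofReal (clampUnit τ x ^ e) * ENNReal.ofReal (clampUnit τ y ^ e') *
    ‖z (clampUnit τ x) (clampUnit τ y)‖ₑ

section TwoParameters

variable {E : Type*} [NormedAddCommGroup E]

lemma measurable_clampedWeightedNorm {Ω : Type*} [MeasurableSpace Ω] {τ : ℝ} (hτ : 0 < τ)
    (hτ1 : τ ≤ 1) (e e' : ℝ) {z : ℝ → ℝ → Ω → E}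
    (hc : ∀ ω, ContinuousOn (fun p : ℝ × ℝ => z p.1 p.2 ω) (Set.Ioc 0 1 ×ˢ Set.Ioc 0 1))
    (hm : ∀ x y, Measurable fun ω => ‖z x y ω‖) :
    Measurable fun p : (ℝ × ℝ) × Ω =>
      clampedWeightedNorm τ e e' (fun x y => z x y p.2) p.1.1 p.1.2 := by
  have hmem (x : ℝ) : clampUnit τ x ∈ Set.Ioc (0 : ℝ) 1 :=
    ⟨hτ.trans_le (clampUnit_mem hτ1 x).1, (clampUnit_mem hτ1 x).2⟩
  have hz : Measurable (Function.uncurry fun (q : ℝ × ℝ) (ω : Ω) =>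
      ‖z (clampUnit τ q.1) (clampUnit τ q.2) ω‖) := by
    refine measurable_uncurry_of_continuous_of_measurable (fun ω => ?_) fun q => hm _ _
    exact ((hc ω).comp_continuous (((continuous_clampUnit τ).comp continuous_fst).prodMk
      ((continuous_clampUnit τ).comp continuous_snd)) fun q => ⟨hmem q.1, hmem q.2⟩).norm
  have hz' : Measurable fun p : (ℝ × ℝ) × Ω =>
      ‖z (clampUnit τ p.1.1) (clampUnit τ p.1.2) p.2‖ₑ := by
    simpa only [Function.uncurry, ofReal_norm] using hz.ennreal_ofReal
  unfold clampedWeightedNorm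
  exact (((measurable_ofReal_clampUnit_rpow τ e).comp (measurable_fst.comp measurable_fst)).mul
    ((measurable_ofReal_clampUnit_rpow τ e').comp (measurable_snd.comp measurable_fst))).mul hz'

lemma rpow_mul_rpow_mul_enorm_le [NormedSpace ℝ E] [CompleteSpace E]
    {z zκ zμ zκμ : ℝ → ℝ → E} {τ a b δ κ μ : ℝ} (hτ : 0 < τ) (ha : a ≤ 0) (hb : b ≤ 0)
    (hd : ∀ κ μ : ℝ, κ ∈ Set.Ioc (0 : ℝ) 1 → μ ∈ Set.Ioc (0 : ℝ) 1 →
      HasDerivAt (fun κ' => z κ' μ) (zκ κ μ) κ ∧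
      HasDerivAt (fun μ' => z κ μ') (zμ κ μ) μ ∧
      HasDerivAt (fun μ' => zκ κ μ') (zκμ κ μ) μ)
    (hκc : ContinuousOn (fun p : ℝ × ℝ => zκ p.1 p.2) (Set.Ioc 0 1 ×ˢ Set.Ioc 0 1))
    (hμc : ContinuousOn (fun p : ℝ × ℝ => zμ p.1 p.2) (Set.Ioc 0 1 ×ˢ Set.Ioc 0 1))
    (hκμc : ContinuousOn (fun p : ℝ × ℝ => zκμ p.1 p.2) (Set.Ioc 0 1 ×ˢ Set.Ioc 0 1))
    (hκ : κ ∈ Set.Icc τ 1) (hμ : μ ∈ Set.Icc τ 1) :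
    ENNReal.ofReal (κ ^ a) * ENNReal.ofReal (μ ^ b) * ‖z κ μ‖ₑ ≤
      clampedWeightedNorm τ a b z τ τ +
      ∫⁻ y, clampedWeightedNorm τ a (b + 1 - δ) zμ τ y ∂powerMeasure δ +
      (∫⁻ x, clampedWeightedNorm τ (a + 1 - δ) b zκ x τ ∂powerMeasure δ +
      ∫⁻ x, ∫⁻ y, clampedWeightedNorm τ (a + 1 - δ) (b + 1 - δ) zκμ x y
        ∂powerMeasure δ ∂powerMeasure δ) := by
  have hτ1 : τ ≤ 1 := hκ.1.trans hκ.2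
  have hsub : Set.Icc τ 1 ⊆ Set.Ioc (0 : ℝ) 1 := fun x hx => ⟨hτ.trans_le hx.1, hx.2⟩
  have hττ : clampUnit τ τ = τ := clampUnit_of_mem ⟨le_rfl, hτ1⟩
  have hτm : τ ∈ Set.Ioc (0 : ℝ) 1 := ⟨hτ, hτ1⟩
  have slice {g : ℝ → ℝ → E} (x : ℝ) (hx : x ∈ Set.Ioc (0 : ℝ) 1)
      (hg : ContinuousOn (fun p : ℝ × ℝ => g p.1 p.2) (Set.Ioc 0 1 ×ˢ Set.Ioc 0 1)) :
      ContinuousOn (g x) (Set.Icc τ 1) :=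
    hg.comp (by fun_prop : ContinuousOn (fun y => (x, y)) (Set.Icc τ 1))
      fun y hy => ⟨hx, hsub hy⟩
  have h₁ := rpow_mul_enorm_le_add_lintegral (f := fun κ' => z κ' μ) (f' := fun κ' => zκ κ' μ)
    (δ := δ) hτ ha (fun x hx => (hd x μ (hsub hx) (hsub hμ)).1)
    (hκc.comp (by fun_prop : ContinuousOn (fun x => (x, μ)) (Set.Icc τ 1))
      fun x hx => ⟨hsub hx, hsub hμ⟩) hκ
  have h₂ := rpow_mul_enorm_le_add_lintegral (f := z τ) (f' := zμ τ) (δ := δ) hτ hb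
    (fun y hy => (hd τ y hτm (hsub hy)).2.1) (slice τ hτm hμc) hμ
  have h₃ (x : ℝ) := rpow_mul_enorm_le_add_lintegral (f := zκ (clampUnit τ x))
    (f' := zκμ (clampUnit τ x)) (δ := δ) hτ hb
    (fun y hy => (hd _ y (hsub (clampUnit_mem hτ1 x)) (hsub hy)).2.2)
    (slice _ (hsub (clampUnit_mem hτ1 x)) hκμc) hμ
  have hmτ : Measurable fun x => clampedWeightedNorm τ (a + 1 - δ) b zκ x τ := by
    have := measurable_clampedWeightedNorm (Ω := Unit) (z := fun x y _ => zκ x y) hτ hτ1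
      (a + 1 - δ) b (fun _ => hκc) (fun _ _ => measurable_const)
    have h := this.comp (by fun_prop : Measurable fun x : ℝ => ((x, τ), ()))
    exact h
  calc ENNReal.ofReal (κ ^ a) * ENNReal.ofReal (μ ^ b) * ‖z κ μ‖ₑ
      = ENNReal.ofReal (μ ^ b) * (ENNReal.ofReal (κ ^ a) * ‖z κ μ‖ₑ) := by ring
    _ ≤ ENNReal.ofReal (μ ^ b) * (ENNReal.ofReal (τ ^ a) * ‖z τ μ‖ₑ +
          ∫⁻ x, ENNReal.ofReal (clampUnit τ x ^ (a + 1 - δ)) * ‖zκ (clampUnit τ x) μ‖ₑ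
            ∂powerMeasure δ) := by gcongr
    _ = ENNReal.ofReal (τ ^ a) * (ENNReal.ofReal (μ ^ b) * ‖z τ μ‖ₑ) +
          ∫⁻ x, ENNReal.ofReal (clampUnit τ x ^ (a + 1 - δ)) *
            (ENNReal.ofReal (μ ^ b) * ‖zκ (clampUnit τ x) μ‖ₑ) ∂powerMeasure δ := by
        rw [mul_add, ← lintegral_const_mul' _ _ ENNReal.ofReal_ne_top]
        simp only [mul_left_comm (ENNReal.ofReal (μ ^ b))]
    _ ≤ ENNReal.ofReal (τ ^ a) * (ENNReal.ofReal (τ ^ b) * ‖z τ τ‖ₑ +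
          ∫⁻ y, ENNReal.ofReal (clampUnit τ y ^ (b + 1 - δ)) * ‖zμ τ (clampUnit τ y)‖ₑ
            ∂powerMeasure δ) +
          ∫⁻ x, ENNReal.ofReal (clampUnit τ x ^ (a + 1 - δ)) *
            (ENNReal.ofReal (τ ^ b) * ‖zκ (clampUnit τ x) τ‖ₑ +
              ∫⁻ y, ENNReal.ofReal (clampUnit τ y ^ (b + 1 - δ)) *
                ‖zκμ (clampUnit τ x) (clampUnit τ y)‖ₑ ∂powerMeasure δ) ∂powerMeasure δ := by
        gcongr with x
        exact h₃ x
    _ = _ := by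
        rw [← lintegral_add_left hmτ, mul_add, ← lintegral_const_mul' _ _ ENNReal.ofReal_ne_top]
        simp only [clampedWeightedNorm, hττ, mul_add, mul_assoc,
          lintegral_const_mul' _ _ ENNReal.ofReal_ne_top]

/-- Kolmogorov-type estimate for a random function of two parameters with values in a Banach
space. -/
theorem lintegral_iSup_rpow_mul_enorm_pow_le [NormedSpace ℝ E] [CompleteSpace E]
    {Ω : Type*} [MeasurableSpace Ω] (P : Measure Ω) [SFinite P]
    {z zκ zμ zκμ : ℝ → ℝ → Ω → E} {a b δ : ℝ} {n : ℕ} {K : ℝ≥0∞} (hn : 0 < n)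
    (ha : a ≤ 0) (hb : b ≤ 0) (hδ : 0 < δ) (hδ1 : δ ≤ 1)
    (hd : ∀ (ω : Ω) (κ μ : ℝ), κ ∈ Set.Ioc (0 : ℝ) 1 → μ ∈ Set.Ioc (0 : ℝ) 1 →
      HasDerivAt (fun κ' => z κ' μ ω) (zκ κ μ ω) κ ∧
      HasDerivAt (fun μ' => z κ μ' ω) (zμ κ μ ω) μ ∧
      HasDerivAt (fun μ' => zκ κ μ' ω) (zκμ κ μ ω) μ)
    (hzc : ∀ ω, ContinuousOn (fun p : ℝ × ℝ => z p.1 p.2 ω) (Set.Ioc 0 1 ×ˢ Set.Ioc 0 1))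
    (hκc : ∀ ω, ContinuousOn (fun p : ℝ × ℝ => zκ p.1 p.2 ω) (Set.Ioc 0 1 ×ˢ Set.Ioc 0 1))
    (hμc : ∀ ω, ContinuousOn (fun p : ℝ × ℝ => zμ p.1 p.2 ω) (Set.Ioc 0 1 ×ˢ Set.Ioc 0 1))
    (hκμc : ∀ ω, ContinuousOn (fun p : ℝ × ℝ => zκμ p.1 p.2 ω) (Set.Ioc 0 1 ×ˢ Set.Ioc 0 1))
    (hzm : ∀ κ μ, Measurable fun ω => ‖z κ μ ω‖) (hκm : ∀ κ μ, Measurable fun ω => ‖zκ κ μ ω‖)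
    (hμm : ∀ κ μ, Measurable fun ω => ‖zμ κ μ ω‖)
    (hκμm : ∀ κ μ, Measurable fun ω => ‖zκμ κ μ ω‖)
    (hzK : ∀ κ ∈ Set.Ioc (0 : ℝ) 1, ∀ μ ∈ Set.Ioc (0 : ℝ) 1,
      ∫⁻ ω, (ENNReal.ofReal (κ ^ a) * ENNReal.ofReal (μ ^ b) * ‖z κ μ ω‖ₑ) ^ n ∂P ≤ K)
    (hκK : ∀ κ ∈ Set.Ioc (0 : ℝ) 1, ∀ μ ∈ Set.Ioc (0 : ℝ) 1,
      ∫⁻ ω, (ENNReal.ofReal (κ ^ (a + 1 - δ)) * ENNReal.ofReal (μ ^ b) * ‖zκ κ μ ω‖ₑ) ^ n ∂P ≤ K)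
    (hμK : ∀ κ ∈ Set.Ioc (0 : ℝ) 1, ∀ μ ∈ Set.Ioc (0 : ℝ) 1,
      ∫⁻ ω, (ENNReal.ofReal (κ ^ a) * ENNReal.ofReal (μ ^ (b + 1 - δ)) * ‖zμ κ μ ω‖ₑ) ^ n ∂P ≤ K)
    (hκμK : ∀ κ ∈ Set.Ioc (0 : ℝ) 1, ∀ μ ∈ Set.Ioc (0 : ℝ) 1,
      ∫⁻ ω, (ENNReal.ofReal (κ ^ (a + 1 - δ)) * ENNReal.ofReal (μ ^ (b + 1 - δ)) *
        ‖zκμ κ μ ω‖ₑ) ^ n ∂P ≤ K) :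
    ∫⁻ ω, ⨆ (κ : ℝ) (_ : κ ∈ Set.Ioc (0 : ℝ) 1) (μ : ℝ) (_ : μ ∈ Set.Ioc (0 : ℝ) 1),
        (ENNReal.ofReal (κ ^ a) * ENNReal.ofReal (μ ^ b) * ‖z κ μ ω‖ₑ) ^ n ∂P ≤
      4 ^ n * (ENNReal.ofReal (1 / δ) ^ n * (ENNReal.ofReal (1 / δ) ^ n * K)) := by
  set M := ENNReal.ofReal (1 / δ) ^ n with hM
  have hM1 : 1 ≤ M := one_le_pow₀ (by
    rw [← ENNReal.ofReal_one]
    exact ENNReal.ofReal_le_ofReal ((one_le_div hδ).2 hδ1))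
  have hMK (L : ℝ≥0∞) : L ≤ M * L := le_mul_of_one_le_left' hM1
  let τ (k : ℕ) : ℝ := 1 / (k + 1)
  have hτ (k : ℕ) : 0 < τ k := by positivity
  have hτ1 (k : ℕ) : τ k ≤ 1 := (div_le_one (by positivity)).2 (by simp)
  have hmem (k : ℕ) (x : ℝ) : clampUnit (τ k) x ∈ Set.Ioc (0 : ℝ) 1 :=
    ⟨(hτ k).trans_le (clampUnit_mem (hτ1 k) x).1, (clampUnit_mem (hτ1 k) x).2⟩
  let G (k : ℕ) (e e' : ℝ) (g : ℝ → ℝ → Ω → E) (x y : ℝ) (ω : Ω) : ℝ≥0∞ :=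
    clampedWeightedNorm (τ k) e e' (fun x y => g x y ω) x y
  let T (k : ℕ) : Fin 4 → Ω → ℝ≥0∞ :=
    ![fun ω => G k a b z (τ k) (τ k) ω,
      fun ω => ∫⁻ y, G k a (b + 1 - δ) zμ (τ k) y ω ∂powerMeasure δ,
      fun ω => ∫⁻ x, G k (a + 1 - δ) b zκ x (τ k) ω ∂powerMeasure δ,
      fun ω => ∫⁻ x, ∫⁻ y, G k (a + 1 - δ) (b + 1 - δ) zκμ x y ω ∂powerMeasure δ ∂powerMeasure δ]
  have hG0 (k : ℕ) : Measurable fun p : (ℝ × ℝ) × Ω => G k a b z p.1.1 p.1.2 p.2 :=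
    measurable_clampedWeightedNorm (hτ k) (hτ1 k) _ _ hzc hzm
  have hG1 (k : ℕ) : Measurable fun p : (ℝ × ℝ) × Ω => G k a (b + 1 - δ) zμ p.1.1 p.1.2 p.2 :=
    measurable_clampedWeightedNorm (hτ k) (hτ1 k) _ _ hμc hμm
  have hG2 (k : ℕ) : Measurable fun p : (ℝ × ℝ) × Ω => G k (a + 1 - δ) b zκ p.1.1 p.1.2 p.2 :=
    measurable_clampedWeightedNorm (hτ k) (hτ1 k) _ _ hκc hκm
  have hG3 (k : ℕ) : Measurable fun p : (ℝ × ℝ) × Ω =>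
      G k (a + 1 - δ) (b + 1 - δ) zκμ p.1.1 p.1.2 p.2 :=
    measurable_clampedWeightedNorm (hτ k) (hτ1 k) _ _ hκμc hκμm
  have hG0' (k : ℕ) : Measurable fun ω => G k a b z (τ k) (τ k) ω := by
    have h := (hG0 k).comp (by fun_prop : Measurable fun ω : Ω => ((τ k, τ k), ω))
    exact h
  have hG1' (k : ℕ) : Measurable fun p : ℝ × Ω => G k a (b + 1 - δ) zμ (τ k) p.1 p.2 := by
    have h := (hG1 k).comp (by fun_prop : Measurable fun p : ℝ × Ω => ((τ k, p.1), p.2))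
    exact h
  have hG2' (k : ℕ) : Measurable fun p : ℝ × Ω => G k (a + 1 - δ) b zκ p.1 (τ k) p.2 := by
    have h := (hG2 k).comp (by fun_prop : Measurable fun p : ℝ × Ω => ((p.1, τ k), p.2))
    exact h
  have hG3' (k : ℕ) : Measurable fun p : ℝ × Ω =>
      ∫⁻ y, G k (a + 1 - δ) (b + 1 - δ) zκμ p.1 y p.2 ∂powerMeasure δ := by
    have h := (hG3 k).comp
      (by fun_prop : Measurable fun q : (ℝ × Ω) × ℝ => ((q.1.1, q.2), q.1.2))
    exact Measurable.lintegral_prod_right' h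
  have hTm (k : ℕ) (i : Fin 4) : Measurable (T k i) := by
    fin_cases i
    · exact hG0' k
    · exact Measurable.lintegral_prod_left' (hG1' k)
    · exact Measurable.lintegral_prod_left' (hG2' k)
    · exact Measurable.lintegral_prod_left' (hG3' k)
  have hJ (F : ℝ → Ω → ℝ≥0∞) (hF : Measurable fun p : ℝ × Ω => F p.1 p.2) (L : ℝ≥0∞)
      (hL : ∀ x, ∫⁻ ω, F x ω ^ n ∂P ≤ L) :
      ∫⁻ ω, (∫⁻ x, F x ω ∂powerMeasure δ) ^ n ∂P ≤ M * L := by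
    rw [hM, ← powerMeasure_univ hδ]
    exact lintegral_lintegral_pow_le _ P hF hn hL
  have hTK (k : ℕ) (i : Fin 4) : ∫⁻ ω, T k i ω ^ n ∂P ≤ M * (M * K) := by
    fin_cases i
    · exact (hzK _ (hmem k _) _ (hmem k _)).trans ((hMK _).trans (hMK _))
    · exact (hJ _ (hG1' k) K fun y => hμK _ (hmem k _) _ (hmem k y)).trans (hMK _)
    · exact (hJ _ (hG2' k) K fun x => hκK _ (hmem k x) _ (hmem k _)).trans (hMK _)
    · refine hJ _ (hG3' k) _ fun x => hJ _ ?_ K fun y => hκμK _ (hmem k x) _ (hmem k y)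
      have h := (hG3 k).comp (by fun_prop : Measurable fun p : ℝ × Ω => ((x, p.1), p.2))
      exact h
  calc ∫⁻ ω, ⨆ (κ : ℝ) (_ : κ ∈ Set.Ioc (0 : ℝ) 1) (μ : ℝ) (_ : μ ∈ Set.Ioc (0 : ℝ) 1),
        (ENNReal.ofReal (κ ^ a) * ENNReal.ofReal (μ ^ b) * ‖z κ μ ω‖ₑ) ^ n ∂P
      ≤ ∫⁻ ω, Filter.liminf (fun k => (∑ i, T k i ω) ^ n) Filter.atTop ∂P := by
        refine lintegral_mono fun ω => ?_
        refine iSup₂_le fun κ hκ => iSup₂_le fun μ hμ => ?_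
        refine Filter.le_liminf_of_le (by isBoundedDefault) ?_
        have hlim : Filter.Tendsto τ Filter.atTop (nhds 0) := tendsto_one_div_add_atTop_nhds_zero_nat
        filter_upwards [hlim.eventually_le_const hκ.1, hlim.eventually_le_const hμ.1]
          with k hkκ hkμ
        gcongr
        refine (rpow_mul_rpow_mul_enorm_le (δ := δ) (hτ k) ha hb (hd ω) (hκc ω) (hμc ω) (hκμc ω)
          ⟨hkκ, hκ.2⟩ ⟨hkμ, hμ.2⟩).trans_eq ?_
        rw [Fin.sum_univ_four, add_assoc (_ + _)]
        rfl
    _ ≤ Filter.liminf (fun k => ∫⁻ ω, (∑ i, T k i ω) ^ n ∂P) Filter.atTop :=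
        lintegral_liminf_le fun k =>
          (Finset.measurable_sum _ fun i _ => hTm k i).pow_const n
    _ ≤ 4 ^ n * (M * (M * K)) := by
        refine (Filter.liminf_le_liminf (v := fun _ : ℕ => (4 : ℝ≥0∞) ^ n * (M * (M * K)))
          (.of_forall fun k => ?_)).trans_eq (Filter.liminf_const _)
        simpa using lintegral_sum_pow_le P (hTm k) hn (hTK k)

end TwoParameters

/-- A moment bound by inverse powers is a uniform moment bound for the weighted norm. -/
lemma lintegral_rpow_mul_rpow_mul_pow_le {Ω : Type*} [MeasurableSpace Ω] {P : Measure Ω}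
    {f : Ω → ℝ≥0∞} {n : ℕ} {C κ μ a b : ℝ} (hκ : 0 < κ) (hμ : 0 < μ)
    (h : ∫⁻ ω, f ω ^ n ∂P ≤ ENNReal.ofReal (C * κ ^ (-(n * a)) * μ ^ (-(n * b)))) :
    ∫⁻ ω, (ENNReal.ofReal (κ ^ a) * ENNReal.ofReal (μ ^ b) * f ω) ^ n ∂P ≤ ENNReal.ofReal C := by
  simp only [mul_pow (_ * _)]
  rw [lintegral_const_mul' _ _ (by finiteness)]
  refine (mul_le_mul_right h _).trans_eq ?_
  rw [← ENNReal.ofReal_mul (by positivity), ← ENNReal.ofReal_pow (by positivity),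
    ← ENNReal.ofReal_mul (by positivity)]
  congr 1
  rw [mul_pow, ← Real.rpow_mul_natCast hκ.le, ← Real.rpow_mul_natCast hμ.le,
    Real.rpow_neg hκ.le, Real.rpow_neg hμ.le, mul_comm (n : ℝ) a, mul_comm (n : ℝ) b]
  field_simp

/-- the probabilistic Kolmogorov-type estimate (Lemma on random functions
`ζ : (0,1]² × Ω → L^∞(𝕋)`): if all mixed `κ`,`μ` derivatives up to order one satisfy the
moment bounds `𝔼‖∂_μ^s∂_κ^u ζ_{κ,μ}‖^n ≤ C [κ]^{−n(w+σu−εu)} [μ]^{−n(ρ+σs−εs)}`, then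
`𝔼 sup_{κ,μ} [κ]^{nw}[μ]^{nρ} ‖ζ_{κ,μ}‖^n ≤ c C`. -/
theorem stmt11 (d : ℕ) (hd : 1 ≤ d) [Fact (0 < 2 * Real.pi)]
    (n : ℕ) (hn : 0 < n) (σ ε : ℝ) (hσ : 0 < σ) (hε0 : 0 < ε) (hεσ : ε < σ) :
    ∃ c : ℝ, 0 < c ∧
      ∀ (Ω : Type) (_ : MeasureSpace Ω) (_ : IsProbabilityMeasure (volume : Measure Ω))
        (ζ ζκ ζμ ζκμ : ℝ → ℝ → Ω →
          Lp ℝ ⊤ (volume : Measure (Fin d → AddCircle (2 * Real.pi))))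
        (C w ρ : ℝ), 0 < C → w ≤ 0 → ρ ≤ 0 →
        -- for each ω, `(κ,μ) ↦ ζ_{κ,μ}` is differentiable with the indicated partial
        -- derivatives `ζκ = ∂_κζ`, `ζμ = ∂_μζ` and mixed partial `ζκμ = ∂_μ∂_κζ`
        (∀ (ω : Ω) (κ μ : ℝ), κ ∈ Set.Ioc (0 : ℝ) 1 → μ ∈ Set.Ioc (0 : ℝ) 1 →
          HasDerivAt (fun κ' => ζ κ' μ ω) (ζκ κ μ ω) κ ∧
          HasDerivAt (fun μ' => ζ κ μ' ω) (ζμ κ μ ω) μ ∧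
          HasDerivAt (fun μ' => ζκ κ μ' ω) (ζκμ κ μ ω) μ) →
        -- continuous differentiability: continuity of `ζ` and of its partial derivatives
        (∀ ω : Ω,
          ContinuousOn (fun p : ℝ × ℝ => ζ p.1 p.2 ω)
            (Set.Ioc (0 : ℝ) 1 ×ˢ Set.Ioc (0 : ℝ) 1) ∧
          ContinuousOn (fun p : ℝ × ℝ => ζκ p.1 p.2 ω)
            (Set.Ioc (0 : ℝ) 1 ×ˢ Set.Ioc (0 : ℝ) 1) ∧
          ContinuousOn (fun p : ℝ × ℝ => ζμ p.1 p.2 ω)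
            (Set.Ioc (0 : ℝ) 1 ×ˢ Set.Ioc (0 : ℝ) 1) ∧
          ContinuousOn (fun p : ℝ × ℝ => ζκμ p.1 p.2 ω)
            (Set.Ioc (0 : ℝ) 1 ×ˢ Set.Ioc (0 : ℝ) 1)) →
        -- measurability in ω of the relevant norms and suprema
        (∀ (u s : ℕ), u ≤ 1 → s ≤ 1 → ∀ κ μ : ℝ,
          Measurable fun ω : Ω =>
            ‖(if u = 0 then (if s = 0 then ζ else ζμ) else (if s = 0 then ζκ else ζκμ))
              κ μ ω‖) →
        Measurable (fun ω : Ω =>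
          ⨆ (κ : ℝ) (_ : κ ∈ Set.Ioc (0 : ℝ) 1) (μ : ℝ) (_ : μ ∈ Set.Ioc (0 : ℝ) 1),
            ENNReal.ofReal (κ ^ ((n * w) / σ) * μ ^ ((n * ρ) / σ)) *
              (‖ζ κ μ ω‖₊ : ℝ≥0∞) ^ n) →
        -- assumed moment bounds, for `u, s ∈ {0,1}`
        (∀ (u s : ℕ), u ≤ 1 → s ≤ 1 → ∀ κ μ : ℝ,
          κ ∈ Set.Ioc (0 : ℝ) 1 → μ ∈ Set.Ioc (0 : ℝ) 1 →
          (∫⁻ ω : Ω,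
              (‖(if u = 0 then (if s = 0 then ζ else ζμ) else (if s = 0 then ζκ else ζκμ))
                κ μ ω‖₊ : ℝ≥0∞) ^ n) ≤
            ENNReal.ofReal (C * κ ^ (-((n : ℝ) * (w + σ * (u : ℝ) - ε * (u : ℝ))) / σ) *
              μ ^ (-((n : ℝ) * (ρ + σ * (s : ℝ) - ε * (s : ℝ))) / σ))) →
        (∫⁻ ω : Ω,
            ⨆ (κ : ℝ) (_ : κ ∈ Set.Ioc (0 : ℝ) 1) (μ : ℝ) (_ : μ ∈ Set.Ioc (0 : ℝ) 1),
              ENNReal.ofReal (κ ^ ((n * w) / σ) * μ ^ ((n * ρ) / σ)) *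
                (‖ζ κ μ ω‖₊ : ℝ≥0∞) ^ n) ≤
          ENNReal.ofReal (c * C) := by
  have hδ : 0 < ε / σ := by positivity
  refine ⟨4 ^ n * ((1 / (ε / σ)) ^ n * (1 / (ε / σ)) ^ n), by positivity, ?_⟩
  intro Ω _ _ ζ ζκ ζμ ζκμ C w ρ hC hw hρ hd hc hm _ hK
  have he₀ (v : ℝ) : -((n : ℝ) * (v + σ * ((0 : ℕ) : ℝ) - ε * ((0 : ℕ) : ℝ))) / σ =
      -(n * (v / σ)) := by
    push_cast; ring
  have he₁ (v : ℝ) : -((n : ℝ) * (v + σ * ((1 : ℕ) : ℝ) - ε * ((1 : ℕ) : ℝ))) / σ =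
      -(n * (v / σ + 1 - ε / σ)) := by
    push_cast; field_simp
  have key := lintegral_iSup_rpow_mul_enorm_pow_le (volume : Measure Ω) (z := ζ) (zκ := ζκ)
    (zμ := ζμ) (zκμ := ζκμ) (K := ENNReal.ofReal C) hn (div_nonpos_of_nonpos_of_nonneg hw hσ.le)
    (div_nonpos_of_nonpos_of_nonneg hρ hσ.le) hδ ((div_le_one hσ).2 hεσ.le) hd
    (fun ω => (hc ω).1) (fun ω => (hc ω).2.1) (fun ω => (hc ω).2.2.1) (fun ω => (hc ω).2.2.2)
    (by simpa using hm 0 0) (by simpa using hm 1 0) (by simpa using hm 0 1)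
    (by simpa using hm 1 1)
    (fun κ hκ μ hμ => lintegral_rpow_mul_rpow_mul_pow_le hκ.1 hμ.1 <| by
      have h := hK 0 0 (by simp) (by simp) κ μ hκ hμ
      rw [he₀, he₀] at h
      exact h)
    (fun κ hκ μ hμ => lintegral_rpow_mul_rpow_mul_pow_le hκ.1 hμ.1 <| by
      have h := hK 1 0 (by simp) (by simp) κ μ hκ hμ
      rw [he₁, he₀] at h
      exact h)
    (fun κ hκ μ hμ => lintegral_rpow_mul_rpow_mul_pow_le hκ.1 hμ.1 <| by
      have h := hK 0 1 (by simp) (by simp) κ μ hκ hμ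
      rw [he₀, he₁] at h
      exact h)
    (fun κ hκ μ hμ => lintegral_rpow_mul_rpow_mul_pow_le hκ.1 hμ.1 <| by
      have h := hK 1 1 (by simp) (by simp) κ μ hκ hμ
      rw [he₁, he₁] at h
      exact h)
  refine le_trans (le_of_eq ?_) (key.trans_eq ?_)
  · refine lintegral_congr fun ω => ?_
    refine iSup_congr fun κ => iSup_congr fun hκ => iSup_congr fun μ => iSup_congr fun hμ => ?_
    have hκ0 := hκ.1
    have hμ0 := hμ.1
    rw [mul_pow, ← ENNReal.ofReal_mul (by positivity), ← ENNReal.ofReal_pow (by positivity),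
      mul_pow, ← Real.rpow_mul_natCast hκ0.le, ← Real.rpow_mul_natCast hμ0.le,
      div_mul_eq_mul_div, div_mul_eq_mul_div, mul_comm w, mul_comm ρ]
    rfl
  · rw [ENNReal.ofReal_mul (by positivity), ENNReal.ofReal_mul (by positivity),
      ENNReal.ofReal_mul (by positivity), ENNReal.ofReal_pow (by positivity),
      ENNReal.ofReal_pow (by positivity)]
    simp [mul_assoc]
end

section
/- Let h ∈ ℕ₊ and m ∈ ℕ. There exists a constant C = C(d, σ, h, m) > 0 such that for every μ > 0 and every bounded continuous 2π-periodic function v : ℝ^d → ℝ, the function W : ℝ^d × (ℝ^d)^m → ℝ defined by W(x; y_1, …, y_m) := ∫_{ℝ^d} K_μ^{*h}(x − z) · (∏_{j=1}^m K_μ^{*h}(y_j − z)) · v(z) dz satisfies ‖W‖_{𝒱^m} ≤ C ‖K_μ^{*h} ∗ v‖_{L^∞(ℝ^d)}. -/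
open MeasureTheory ENNReal Real

/-- Density of the convolution power `K_μ^{*(n+1)}`. -/
noncomputable def kdens (d : ℕ) (σ μ : ℝ) : ℕ → (Fin d → ℝ) → ℝ≥0∞
  | 0 => Kker d σ μ
  | n + 1 => fun x => ∫⁻ z, Kker d σ μ z * kdens d σ μ n (x - z)

/-- The real-valued density of `K_μ^{*h}` for `h ≥ 1`. -/
noncomputable def kdR (d : ℕ) (σ μ : ℝ) (h : ℕ) (x : Fin d → ℝ) : ℝ :=
  (kdens d σ μ (h - 1) x).toReal

/-- The norm `‖V‖_{𝒱^m} := sup_x ∫_{(ℝ^d)^m} |V(x; y₁,…,y_m)| dy`, valued in `ℝ≥0∞`. -/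
noncomputable def Vnorm (d m : ℕ) (V : (Fin d → ℝ) → (Fin m → Fin d → ℝ) → ℝ) : ℝ≥0∞ :=
  ⨆ x : Fin d → ℝ, ∫⁻ y : Fin m → Fin d → ℝ, (‖V x y‖₊ : ℝ≥0∞)


/-- The centred one-dimensional Gaussian density of variance `2 * s`. -/
noncomputable def heat (s y : ℝ) : ℝ := (√(4 * π * s))⁻¹ * Real.exp (-(4 * s)⁻¹ * y ^ 2)

lemma heat_nonneg (s y : ℝ) : 0 ≤ heat s y := by unfold heat; positivity

lemma measurable_heat_uncurry {α : Type*} [MeasurableSpace α] {f g : α → ℝ}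
    (hf : Measurable f) (hg : Measurable g) : Measurable fun x => heat (f x) (g x) := by
  unfold heat; fun_prop

lemma integrable_heat {s : ℝ} (hs : 0 < s) : Integrable (heat s) :=
  (integrable_exp_neg_mul_sq (by positivity)).const_mul _

lemma integrable_mul_heat {s : ℝ} (hs : 0 < s) : Integrable fun y => y * heat s y := by
  have := (integrable_mul_exp_neg_mul_sq (b := (4 * s)⁻¹) (by positivity)).const_mul
    (√(4 * π * s))⁻¹
  refine this.congr (.of_forall fun y => ?_)
  simp only [heat]; ring

lemma integral_heat_cexp {s : ℝ} (hs : 0 < s) (θ : ℝ) :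
    ∫ y, (heat s y : ℂ) * Complex.exp ((θ * y : ℝ) * Complex.I) = Real.exp (-s * θ ^ 2) := by
  have h := fourierIntegral_gaussian (b := (((4 * s)⁻¹ : ℝ) : ℂ))
    (by rw [Complex.ofReal_re]; positivity) θ
  have e : ∀ y : ℝ, (heat s y : ℂ) * Complex.exp ((θ * y : ℝ) * Complex.I) =
      ((√(4 * π * s))⁻¹ : ℝ) * (Complex.exp (Complex.I * θ * y) *
        Complex.exp (-(((4 * s)⁻¹ : ℝ) : ℂ) * (y : ℂ) ^ 2)) := by
    intro y
    simp only [heat]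
    push_cast
    rw [show (θ : ℂ) * y * Complex.I = Complex.I * θ * y by ring]
    ring
  simp_rw [e]
  rw [integral_const_mul, h]
  have h1 : ((π : ℂ) / (((4 * s)⁻¹ : ℝ) : ℂ)) ^ ((1 : ℂ) / 2) = ((√(4 * π * s) : ℝ) : ℂ) := by
    rw [Real.sqrt_eq_rpow, Complex.ofReal_cpow (by positivity)]
    push_cast
    congr 1
    field_simp
  rw [h1, ← mul_assoc, ← Complex.ofReal_mul, inv_mul_cancel₀ (by positivity)]
  push_cast
  rw [one_mul]
  congr 1
  have : (s : ℂ) ≠ 0 := by exact_mod_cast hs.ne'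
  field_simp

lemma norm_cexp_ofReal_mul_I_mul (r θ y : ℝ) :
    ‖(r : ℂ) * Complex.exp ((θ * y : ℝ) * Complex.I)‖ = |r| := by
  rw [norm_mul, Complex.norm_exp_ofReal_mul_I, mul_one, Complex.norm_real, Real.norm_eq_abs]

lemma integrable_mul_cexp {f : ℝ → ℝ} (hf : Integrable f) (θ : ℝ) :
    Integrable fun y => (f y : ℂ) * Complex.exp ((θ * y : ℝ) * Complex.I) := by
  refine (hf.norm).mono' (hf.ofReal.aestronglyMeasurable.mul (by fun_prop)) (.of_forall fun y => ?_)
  rw [norm_cexp_ofReal_mul_I_mul, Real.norm_eq_abs]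

lemma integral_mul_heat_cexp {s : ℝ} (hs : 0 < s) (θ : ℝ) :
    ∫ y, ((y * heat s y : ℝ) : ℂ) * Complex.exp ((θ * y : ℝ) * Complex.I) =
      2 * s * Complex.I * θ * Real.exp (-s * θ ^ 2) := by
  have hd : ∀ y : ℝ, HasDerivAt
      (fun y : ℝ => (heat s y : ℂ) * Complex.exp ((θ * y : ℝ) * Complex.I))
      (-(2 * s : ℂ)⁻¹ * (((y * heat s y : ℝ) : ℂ) * Complex.exp ((θ * y : ℝ) * Complex.I)) +
        Complex.I * θ * ((heat s y : ℂ) * Complex.exp ((θ * y : ℝ) * Complex.I))) y := by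
    intro y
    have h1 : HasDerivAt (heat s) (-(2 * s)⁻¹ * (y * heat s y)) y := by
      have := (((hasDerivAt_pow 2 y).const_mul (-(4 * s)⁻¹)).exp).const_mul (√(4 * π * s))⁻¹
      refine this.congr_deriv ?_
      simp only [heat]
      field_simp
      ring
    have h2 : HasDerivAt (fun y : ℝ => Complex.exp ((θ * y : ℝ) * Complex.I))
        (Complex.exp ((θ * y : ℝ) * Complex.I) * (θ * Complex.I)) y := by
      have h3 : HasDerivAt (fun y : ℝ => ((θ * y : ℝ) : ℂ)) (θ : ℂ) y := by
        have := ((hasDerivAt_id y).const_mul θ).ofReal_comp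
        simpa using this
      exact (h3.mul_const Complex.I).cexp
    refine (h1.ofReal_comp.mul h2).congr_deriv ?_
    push_cast
    ring
  have i1 := (integrable_mul_cexp (integrable_mul_heat hs) θ).const_mul (-(2 * s : ℂ)⁻¹)
  have i2 := integrable_mul_cexp (integrable_heat hs) θ
  have i3 := i2.const_mul (Complex.I * θ)
  have := integral_eq_zero_of_hasDerivAt_of_integrable hd (i1.add i3) i2
  rw [integral_add i1 i3, integral_const_mul, integral_const_mul, integral_heat_cexp hs] at this
  have hs' : (s : ℂ) ≠ 0 := by exact_mod_cast hs.ne'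
  generalize (∫ y, ((y * heat s y : ℝ) : ℂ) * Complex.exp ((θ * y : ℝ) * Complex.I)) = J at this ⊢
  generalize ((Real.exp (-s * θ ^ 2) : ℝ) : ℂ) = G at this ⊢
  field_simp at this
  linear_combination (-1 : ℂ) * this

lemma integral_heat {s : ℝ} (hs : 0 < s) : ∫ y, heat s y = 1 := by
  have := integral_heat_cexp hs 0
  simp only [zero_mul, Complex.ofReal_zero, Complex.exp_zero, mul_one] at this
  rw [integral_complex_ofReal] at this
  simpa using this

lemma integral_abs_mul_heat {s : ℝ} (hs : 0 < s) :
    ∫ y, |y| * heat s y = (√(4 * π * s))⁻¹ * (4 * s) := by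
  have h1 := integral_comp_abs (f := fun y => y * heat s y)
  have h2 := integral_rpow_mul_exp_neg_mul_rpow (p := 2) (q := 1) (b := (4 * s)⁻¹) (by norm_num)
    (by norm_num) (by positivity)
  have e : ∀ y : ℝ, |y| * heat s |y| = |y| * heat s y := by intro y; simp [heat]
  simp only [e] at h1
  rw [h1]
  have e2 : ∀ y : ℝ, y * heat s y =
      (√(4 * π * s))⁻¹ * (y ^ (1 : ℝ) * Real.exp (-(4 * s)⁻¹ * y ^ (2 : ℝ))) := by
    intro y; simp [heat]; ring
  simp_rw [e2]
  rw [integral_const_mul, h2]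
  norm_num
  rw [Real.rpow_neg_one]
  field_simp

lemma dual_pi_apply {d : ℕ} (L : StrongDual ℝ (Fin d → ℝ)) (x : Fin d → ℝ) :
    L x = ∑ k, L (Pi.single k 1) * x k := by
  conv_lhs => rw [pi_eq_sum_univ' x, map_sum]
  refine Finset.sum_congr rfl fun k _ => ?_
  rw [map_smul, smul_eq_mul, mul_comm]

lemma integral_prod_mul_cexp_dual {d : ℕ} (f : Fin d → ℝ → ℝ) (L : StrongDual ℝ (Fin d → ℝ)) :
    ∫ x : Fin d → ℝ, ((∏ k, f k (x k) : ℝ) : ℂ) * Complex.exp (L x * Complex.I) =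
      ∏ k, ∫ y, (f k y : ℂ) * Complex.exp ((L (Pi.single k 1) * y : ℝ) * Complex.I) := by
  rw [← integral_fintype_prod_volume_eq_prod (𝕜 := ℂ) (fun k y =>
    (f k y : ℂ) * Complex.exp ((L (Pi.single k 1) * y : ℝ) * Complex.I))]
  refine integral_congr_ae (.of_forall fun x => ?_)
  simp only
  rw [Finset.prod_mul_distrib, ← Complex.exp_sum, ← Finset.sum_mul, dual_pi_apply L x]
  push_cast
  rfl

/-- Lebesgue measure on `(0, ∞) × ℝ^d`. -/
noncomputable abbrev timeSpace (d : ℕ) : Measure (ℝ × (Fin d → ℝ)) :=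
  (volume.restrict (Set.Ioi 0)).prod volume

lemma integrable_timeSpace {d : ℕ} {c : ℝ → ℝ} {f : Fin d → ℝ → ℝ → ℝ} (hc : Measurable c)
    (hf : ∀ k, Measurable fun p : ℝ × ℝ => f k p.1 p.2)
    (hi : ∀ t, 0 < t → ∀ k, Integrable (f k t))
    (hI : IntegrableOn (fun t => |c t| * ∏ k, ∫ y, |f k t y|) (Set.Ioi 0)) :
    Integrable (fun p : ℝ × (Fin d → ℝ) => c p.1 * ∏ k, f k p.1 (p.2 k)) (timeSpace d) := by
  have hm : Measurable fun p : ℝ × (Fin d → ℝ) => c p.1 * ∏ k, f k p.1 (p.2 k) := by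
    refine (hc.comp measurable_fst).mul (Finset.measurable_prod _ fun k _ => ?_)
    exact (hf k).comp (measurable_fst.prodMk ((measurable_pi_apply k).comp measurable_snd))
  rw [integrable_prod_iff hm.aestronglyMeasurable]
  refine ⟨?_, ?_⟩
  · refine (ae_restrict_iff' measurableSet_Ioi).2 (.of_forall fun t ht => ?_)
    have : Integrable (fun x : Fin d → ℝ => ∏ k, f k t (x k)) :=
      Integrable.fintype_prod (f := fun k => f k t) (hi t ht)
    exact this.const_mul (c t)
  · refine hI.congr_fun (fun t _ => ?_) measurableSet_Ioi
    simp only [norm_mul, Real.norm_eq_abs, Finset.abs_prod]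
    rw [integral_const_mul, integral_fintype_prod_volume_eq_prod (fun k y => |f k t y|)]

lemma integral_timeSpace_cexp {d : ℕ} {c : ℝ → ℝ} {f : Fin d → ℝ → ℝ → ℝ}
    (hi : Integrable (fun p : ℝ × (Fin d → ℝ) => c p.1 * ∏ k, f k p.1 (p.2 k)) (timeSpace d))
    (L : StrongDual ℝ (Fin d → ℝ)) :
    ∫ p, ((c p.1 * ∏ k, f k p.1 (p.2 k) : ℝ) : ℂ) * Complex.exp (L p.2 * Complex.I) ∂timeSpace d =
      ∫ t in Set.Ioi (0 : ℝ), (c t : ℂ) * ∏ k, ∫ y, (f k t y : ℂ) *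
        Complex.exp ((L (Pi.single k 1) * y : ℝ) * Complex.I) := by
  rw [integral_prod]
  · refine integral_congr_ae (.of_forall fun t => ?_)
    simp only
    rw [← integral_prod_mul_cexp_dual, ← integral_const_mul]
    push_cast
    simp only [mul_assoc]
  · refine hi.norm.mono' (hi.ofReal.aestronglyMeasurable.mul (by fun_prop)) (.of_forall fun p => ?_)
    rw [norm_mul, Complex.norm_exp_ofReal_mul_I, mul_one, Complex.norm_real]

lemma integral_exp_neg_mul_cexp_sum {d : ℕ} {A : ℝ} (hA : 0 < A) (θ : Fin d → ℝ) :
    ∫ t in Set.Ioi (0 : ℝ), ((Real.exp (-t) : ℝ) : ℂ) * ∏ k, ((Real.exp (-(t * A) * θ k ^ 2) : ℝ) : ℂ)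
      = (1 + A * ∑ k, (θ k : ℂ) ^ 2)⁻¹ := by
  have e : ∀ t : ℝ, ((Real.exp (-t) : ℝ) : ℂ) * ∏ k, ((Real.exp (-(t * A) * θ k ^ 2) : ℝ) : ℂ) =
      ((Real.exp (-(1 + A * ∑ k, θ k ^ 2) * t) : ℝ) : ℂ) := by
    intro t
    rw [← Complex.ofReal_prod, ← Real.exp_sum, ← Complex.ofReal_mul, ← Real.exp_add,
      ← Finset.mul_sum]
    congr 2
    ring
  simp_rw [e]
  have hpos : 0 < 1 + A * ∑ k, θ k ^ 2 := by positivity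
  rw [integral_complex_ofReal, integral_exp_mul_Ioi (by linarith), mul_zero,
    Real.exp_zero, neg_div_neg_eq, one_div]
  push_cast
  rfl

/-- The joint density of the time and space variables in the subordination formula. -/
noncomputable def subDens (d : ℕ) (A : ℝ) (p : ℝ × (Fin d → ℝ)) : ℝ :=
  Real.exp (-p.1) * ∏ k, heat (p.1 * A) (p.2 k)

lemma subDens_nonneg (d : ℕ) (A : ℝ) (p : ℝ × (Fin d → ℝ)) : 0 ≤ subDens d A p :=
  mul_nonneg (Real.exp_pos _).le (Finset.prod_nonneg fun _ _ => heat_nonneg _ _)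

lemma integrable_subDens (d : ℕ) {A : ℝ} (hA : 0 < A) : Integrable (subDens d A) (timeSpace d) := by
  refine integrable_timeSpace (c := fun t => Real.exp (-t)) (f := fun _ t => heat (t * A))
    (by fun_prop) (fun k => measurable_heat_uncurry (by fun_prop) (by fun_prop))
    (fun t ht _ => integrable_heat (by positivity)) ?_
  refine (integrableOn_exp_neg_Ioi 0).congr_fun (fun t ht => ?_) measurableSet_Ioi
  simp only [abs_of_nonneg (heat_nonneg _ _), Real.abs_exp]
  rw [Finset.prod_eq_one, mul_one]
  intro k _
  exact integral_heat (mul_pos ht hA)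

lemma integral_subDens_cexp (d : ℕ) {A : ℝ} (hA : 0 < A) (L : StrongDual ℝ (Fin d → ℝ)) :
    ∫ p, (subDens d A p : ℂ) * Complex.exp (L p.2 * Complex.I) ∂timeSpace d =
      (1 + A * ∑ k, (L (Pi.single k 1) : ℂ) ^ 2)⁻¹ := by
  refine (integral_timeSpace_cexp (c := fun t => Real.exp (-t)) (f := fun _ t => heat (t * A))
    (integrable_subDens d hA) L).trans ?_
  rw [← integral_exp_neg_mul_cexp_sum hA]
  refine setIntegral_congr_fun measurableSet_Ioi fun t ht => ?_
  simp only [integral_heat_cexp (mul_pos ht hA)]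

/-- The density of the `l`-th partial derivative of the heat flow, up to sign. -/
noncomputable def gradDens (d : ℕ) (l : Fin d) (p : ℝ × (Fin d → ℝ)) : ℝ :=
  Real.exp (-p.1) * (2 * p.1)⁻¹ *
    ∏ k, if k = l then p.2 k * heat p.1 (p.2 k) else heat p.1 (p.2 k)

lemma integrable_gradDens (d : ℕ) (l : Fin d) : Integrable (gradDens d l) (timeSpace d) := by
  refine integrable_timeSpace (c := fun t => Real.exp (-t) * (2 * t)⁻¹)
    (f := fun k t y => if k = l then y * heat t y else heat t y) (by fun_prop) (fun k => ?_)
    (fun t ht k => ?_) ?_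
  · split_ifs
    · exact measurable_snd.mul (measurable_heat_uncurry measurable_fst measurable_snd)
    · exact measurable_heat_uncurry measurable_fst measurable_snd
  · split_ifs
    exacts [integrable_mul_heat ht, integrable_heat ht]
  · have := (Real.GammaIntegral_convergent (s := 1 / 2) (by norm_num)).const_mul (√π)⁻¹
    refine IntegrableOn.congr_fun this (fun t ht => ?_) measurableSet_Ioi
    have ht' : 0 < t := ht
    have h1 : ∀ k, (∫ y, |if k = l then y * heat t y else heat t y|) =
        if k = l then (√(4 * π * t))⁻¹ * (4 * t) else 1 := by
      intro k
      split_ifs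
      · simp only [abs_mul, abs_of_nonneg (heat_nonneg _ _)]
        exact integral_abs_mul_heat ht'
      · simp only [abs_of_nonneg (heat_nonneg _ _)]
        exact integral_heat ht'
    simp only [h1, Finset.prod_ite_eq', Finset.mem_univ, if_true]
    rw [abs_of_nonneg (by positivity), show (4 : ℝ) * π * t = 2 ^ 2 * π * t by norm_num,
      Real.sqrt_mul (by positivity), Real.sqrt_mul (by positivity), Real.sqrt_sq (by norm_num),
      show (1 / 2 - 1 : ℝ) = -(1 / 2) by norm_num, Real.rpow_neg ht'.le, ← Real.sqrt_eq_rpow]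
    field_simp
    ring

lemma integral_gradDens_cexp (d : ℕ) (l : Fin d) (L : StrongDual ℝ (Fin d → ℝ)) :
    ∫ p, (gradDens d l p : ℂ) * Complex.exp (L p.2 * Complex.I) ∂timeSpace d =
      Complex.I * L (Pi.single l 1) * (1 + ∑ k, (L (Pi.single k 1) : ℂ) ^ 2)⁻¹ := by
  refine (integral_timeSpace_cexp (c := fun t => Real.exp (-t) * (2 * t)⁻¹)
    (f := fun k t y => if k = l then y * heat t y else heat t y) (integrable_gradDens d l)
    L).trans ?_
  have h := integral_exp_neg_mul_cexp_sum one_pos (fun k => L (Pi.single k 1))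
  rw [Complex.ofReal_one, one_mul] at h
  rw [← h, ← integral_const_mul]
  refine setIntegral_congr_fun measurableSet_Ioi fun t ht => ?_
  have ht' : (t : ℂ) ≠ 0 := by exact_mod_cast (ne_of_gt ht)
  have h1 : ∀ k, (∫ y, ((if k = l then y * heat t y else heat t y : ℝ) : ℂ) *
      Complex.exp ((L (Pi.single k 1) * y : ℝ) * Complex.I)) =
      (if k = l then 2 * t * Complex.I * L (Pi.single k 1) else 1) *
        Real.exp (-t * L (Pi.single k 1) ^ 2) := by
    intro k
    split_ifs
    · exact integral_mul_heat_cexp ht _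
    · rw [one_mul]; exact integral_heat_cexp ht _
  simp only [h1, Finset.prod_mul_distrib, Finset.prod_ite_eq', Finset.mem_univ, if_true, mul_one]
  push_cast
  field_simp

lemma rpow_two_div_pos {σ μ : ℝ} (hμ : 0 < μ) : 0 < μ ^ ((2 : ℝ) / σ) := Real.rpow_pos_of_pos hμ _

lemma subDens_eq (d : ℕ) {t A : ℝ} (ht : 0 < t) (hA : 0 < A) (x : Fin d → ℝ) :
    Real.exp (-t) * (4 * π * t * A) ^ (-(d : ℝ) / 2) *
      Real.exp (-(∑ i, x i ^ 2) / (4 * t * A)) = subDens d A (t, x) := by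
  have hB : 0 < 4 * π * t * A := by positivity
  simp only [subDens, heat, Finset.prod_mul_distrib, Finset.prod_const, Finset.card_univ,
    Fintype.card_fin, ← Real.exp_sum, ← Finset.mul_sum, ← mul_assoc]
  congr 2
  · rw [Real.sqrt_eq_rpow, ← Real.rpow_neg hB.le, ← Real.rpow_natCast, ← Real.rpow_mul hB.le]
    congr 1
    ring
  · rw [div_eq_inv_mul, mul_neg, neg_mul]

lemma Kker_eq (d : ℕ) {σ μ : ℝ} (hμ : 0 < μ) (x : Fin d → ℝ) :
    Kker d σ μ x = ∫⁻ t in Set.Ioi (0 : ℝ),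
      ENNReal.ofReal (subDens d (μ ^ ((2 : ℝ) / σ)) (t, x)) := by
  refine setLIntegral_congr_fun measurableSet_Ioi fun t ht => ?_
  rw [← subDens_eq d ht (rpow_two_div_pos hμ)]

lemma measurable_subDens (d : ℕ) (A : ℝ) : Measurable (subDens d A) := by
  unfold subDens
  refine Measurable.mul (by fun_prop) (Finset.measurable_prod _ fun k _ => ?_)
  exact measurable_heat_uncurry (by fun_prop) (by fun_prop)

lemma withDensity_Kker (d : ℕ) {σ μ : ℝ} (hμ : 0 < μ) :
    volume.withDensity (Kker d σ μ) = ((timeSpace d).withDensity fun p =>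
      ENNReal.ofReal (subDens d (μ ^ ((2 : ℝ) / σ)) p)).map Prod.snd := by
  have hm := (measurable_subDens d (μ ^ ((2 : ℝ) / σ))).ennreal_ofReal
  refine Measure.ext_of_lintegral _ fun f hf => ?_
  have hf' : Measurable fun p : ℝ × (Fin d → ℝ) => f p.2 := hf.comp measurable_snd
  rw [lintegral_map hf measurable_snd, lintegral_withDensity_eq_lintegral_mul _ hm hf',
    lintegral_prod_symm' _ (hm.mul hf')]
  have hK : Measurable (Kker d σ μ) := by
    simp_rw [funext (Kker_eq d (σ := σ) hμ)]
    exact hm.lintegral_prod_left'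
  rw [lintegral_withDensity_eq_lintegral_mul _ hK hf]
  refine lintegral_congr fun x => ?_
  simp only [Pi.mul_apply]
  rw [Kker_eq d hμ]
  exact (lintegral_mul_const _ (hm.comp measurable_prodMk_right)).symm

lemma measurable_Kker (d : ℕ) {σ μ : ℝ} (hμ : 0 < μ) : Measurable (Kker d σ μ) := by
  simp_rw [funext (Kker_eq d (σ := σ) hμ)]
  exact (measurable_subDens d (μ ^ ((2 : ℝ) / σ))).ennreal_ofReal.lintegral_prod_left'

lemma isFiniteMeasure_Kker (d : ℕ) {σ μ : ℝ} (hμ : 0 < μ) :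
    IsFiniteMeasure (volume.withDensity (Kker d σ μ)) := by
  rw [withDensity_Kker d hμ]
  have := isFiniteMeasure_withDensity_ofReal (integrable_subDens d (rpow_two_div_pos (σ := σ) hμ)).2
  infer_instance

/-- The Fourier transform of the resolvent kernel with scale parameter `A`. -/
noncomputable def resolventSymbol {d : ℕ} (A : ℝ) (L : StrongDual ℝ (Fin d → ℝ)) : ℂ :=
  (1 + A * ∑ k, (L (Pi.single k 1) : ℂ) ^ 2)⁻¹

lemma charFunDual_Kker (d : ℕ) {σ μ : ℝ} (hμ : 0 < μ) (L : StrongDual ℝ (Fin d → ℝ)) :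
    charFunDual (volume.withDensity (Kker d σ μ)) L = resolventSymbol (μ ^ ((2 : ℝ) / σ)) L := by
  rw [withDensity_Kker d hμ, charFunDual_apply, integral_map measurable_snd.aemeasurable
    (by fun_prop), integral_withDensity_eq_integral_toReal_smul
    (measurable_subDens d _).ennreal_ofReal (by simp), resolventSymbol,
    ← integral_subDens_cexp d (rpow_two_div_pos hμ)]
  refine integral_congr_ae (.of_forall fun p => ?_)
  simp only [ENNReal.toReal_ofReal (subDens_nonneg _ _ _), Complex.real_smul]

lemma measurable_kdens (d : ℕ) {σ μ : ℝ} (hμ : 0 < μ) (n : ℕ) : Measurable (kdens d σ μ n) := by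
  induction n with
  | zero => exact measurable_Kker d hμ
  | succ n ih =>
    have h : Measurable fun p : (Fin d → ℝ) × (Fin d → ℝ) =>
        Kker d σ μ p.2 * kdens d σ μ n (p.1 - p.2) :=
      ((measurable_Kker d hμ).comp measurable_snd).mul
        (ih.comp (measurable_fst.sub measurable_snd))
    exact h.lintegral_prod_right'

lemma withDensity_kdens_succ (d : ℕ) {σ μ : ℝ} (hμ : 0 < μ) (n : ℕ) :
    volume.withDensity (kdens d σ μ (n + 1)) =
      volume.withDensity (Kker d σ μ) ∗ volume.withDensity (kdens d σ μ n) := by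
  rw [conv_withDensity_eq_lconvolution (measurable_Kker d hμ) (measurable_kdens d hμ n)]
  congr 1
  funext x
  rw [lconvolution_def]
  simp only [kdens, sub_eq_neg_add]

lemma isFiniteMeasure_kdens (d : ℕ) {σ μ : ℝ} (hμ : 0 < μ) (n : ℕ) :
    IsFiniteMeasure (volume.withDensity (kdens d σ μ n)) := by
  have := isFiniteMeasure_Kker d (σ := σ) hμ
  induction n with
  | zero => exact this
  | succ n ih => rw [withDensity_kdens_succ d hμ]; infer_instance

lemma charFunDual_kdens (d : ℕ) {σ μ : ℝ} (hμ : 0 < μ) (n : ℕ) (L : StrongDual ℝ (Fin d → ℝ)) :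
    charFunDual (volume.withDensity (kdens d σ μ n)) L =
      resolventSymbol (μ ^ ((2 : ℝ) / σ)) L ^ (n + 1) := by
  have := isFiniteMeasure_Kker d (σ := σ) hμ
  induction n with
  | zero => rw [zero_add, pow_one]; exact charFunDual_Kker d hμ L
  | succ n ih =>
    have := isFiniteMeasure_kdens d (σ := σ) hμ n
    rw [withDensity_kdens_succ d hμ, charFunDual_conv, ih, charFunDual_Kker d hμ, ← pow_succ']

lemma measurable_kdR (d : ℕ) {σ μ : ℝ} (hμ : 0 < μ) (h : ℕ) : Measurable (kdR d σ μ h) :=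
  (measurable_kdens d hμ _).ennreal_toReal

lemma lintegral_kdens_ne_top (d : ℕ) {σ μ : ℝ} (hμ : 0 < μ) (n : ℕ) :
    ∫⁻ x, kdens d σ μ n x ≠ ∞ := by
  have := isFiniteMeasure_kdens d (σ := σ) hμ n
  have h := measure_ne_top (volume.withDensity (kdens d σ μ n)) Set.univ
  rwa [withDensity_apply _ .univ, setLIntegral_univ] at h

lemma integrable_kdR (d : ℕ) {σ μ : ℝ} (hμ : 0 < μ) (h : ℕ) : Integrable (kdR d σ μ h) :=
  integrable_toReal_of_lintegral_ne_top (measurable_kdens d hμ _).aemeasurable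
    (lintegral_kdens_ne_top d hμ _)

lemma withDensity_kdR (d : ℕ) {σ μ : ℝ} (hμ : 0 < μ) (h : ℕ) :
    volume.withDensity (fun x => ENNReal.ofReal (kdR d σ μ h x)) =
      volume.withDensity (kdens d σ μ (h - 1)) := by
  refine withDensity_congr_ae ?_
  filter_upwards [ae_lt_top (measurable_kdens d hμ (h - 1)) (lintegral_kdens_ne_top d hμ _)]
    with x hx
  exact ENNReal.ofReal_toReal hx.ne

section FourierStieltjes

variable {E F : Type*} [NormedAddCommGroup E] [NormedSpace ℝ E] [MeasurableSpace E] [BorelSpace E]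
  [NormedAddCommGroup F] [NormedSpace ℝ F] [MeasurableSpace F] [BorelSpace F]

/-- `f` is the Fourier transform of a finite signed measure, written as a difference of two finite
measures. -/
def IsSignedTransform {E : Type*} [NormedAddCommGroup E] [NormedSpace ℝ E] [MeasurableSpace E]
    (f : StrongDual ℝ E → ℂ) : Prop :=
  ∃ p n : Measure E, IsFiniteMeasure p ∧ IsFiniteMeasure n ∧
    ∀ L, f L = charFunDual p L - charFunDual n L

lemma charFunDual_add_measure (p n : Measure E) [IsFiniteMeasure p] [IsFiniteMeasure n]
    (L : StrongDual ℝ E) : charFunDual (p + n) L = charFunDual p L + charFunDual n L := by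
  rw [charFunDual, integral_add_measure ((BoundedContinuousFunction.probCharDual L).integrable _)
    ((BoundedContinuousFunction.probCharDual L).integrable _)]
  rfl

namespace IsSignedTransform

variable {f g : StrongDual ℝ E → ℂ}

lemma neg {E : Type*} [NormedAddCommGroup E] [NormedSpace ℝ E] [MeasurableSpace E]
    {f : StrongDual ℝ E → ℂ} (hf : IsSignedTransform f) : IsSignedTransform fun L => -f L := by
  obtain ⟨p, n, hp, hn, h⟩ := hf
  exact ⟨n, p, hn, hp, fun L => by simp only [h, neg_sub]⟩

lemma add (hf : IsSignedTransform f) (hg : IsSignedTransform g) :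
    IsSignedTransform fun L => f L + g L := by
  obtain ⟨p, n, hp, hn, h⟩ := hf
  obtain ⟨p', n', hp', hn', h'⟩ := hg
  refine ⟨p + p', n + n', inferInstance, inferInstance, fun L => ?_⟩
  simp only [h, h', charFunDual_add_measure]
  ring

lemma sub (hf : IsSignedTransform f) (hg : IsSignedTransform g) :
    IsSignedTransform fun L => f L - g L := by
  simpa only [sub_eq_add_neg] using hf.add hg.neg

lemma mul [SecondCountableTopology E] (hf : IsSignedTransform f) (hg : IsSignedTransform g) :
    IsSignedTransform fun L => f L * g L := by
  obtain ⟨p, n, hp, hn, h⟩ := hf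
  obtain ⟨p', n', hp', hn', h'⟩ := hg
  refine ⟨p ∗ p' + n ∗ n', p ∗ n' + n ∗ p', inferInstance, inferInstance, fun L => ?_⟩
  simp only [h, h', charFunDual_add_measure, charFunDual_conv]
  ring

lemma one : IsSignedTransform fun _ : StrongDual ℝ E => (1 : ℂ) :=
  ⟨Measure.dirac 0, 0, inferInstance, inferInstance, fun L => by
    simp [charFunDual, BoundedContinuousFunction.probCharDual_apply]⟩

lemma zero : IsSignedTransform fun _ : StrongDual ℝ E => (0 : ℂ) := by
  simpa using (one (E := E)).sub one

lemma sum {ι : Type*} (s : Finset ι) {f : ι → StrongDual ℝ E → ℂ}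
    (hf : ∀ i ∈ s, IsSignedTransform (f i)) : IsSignedTransform fun L => ∑ i ∈ s, f i L := by
  induction s using Finset.cons_induction with
  | empty => simpa using zero
  | cons a s ha ih =>
    simp only [Finset.sum_cons]
    exact (hf a (by simp)).add (ih fun i hi => hf i (by simp [hi]))

lemma prod [SecondCountableTopology E] {ι : Type*} (s : Finset ι) {f : ι → StrongDual ℝ E → ℂ}
    (hf : ∀ i ∈ s, IsSignedTransform (f i)) : IsSignedTransform fun L => ∏ i ∈ s, f i L := by
  induction s using Finset.cons_induction with
  | empty => simpa using one
  | cons a s ha ih =>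
    simp only [Finset.prod_cons]
    exact (hf a (by simp)).mul (ih fun i hi => hf i (by simp [hi]))

lemma pow [SecondCountableTopology E] (hf : IsSignedTransform f) (n : ℕ) :
    IsSignedTransform fun L => f L ^ n := by
  simpa using prod (Finset.range n) (f := fun _ => f) fun _ _ => hf

lemma comp_dual (hf : IsSignedTransform f) (T : E →L[ℝ] F) :
    IsSignedTransform fun L : StrongDual ℝ F => f (L ∘SL T) := by
  obtain ⟨p, n, hp, hn, h⟩ := hf
  exact ⟨p.map T, n.map T, inferInstance, inferInstance, fun L => by
    simp only [h, charFunDual_map]⟩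

lemma of_density {E : Type*} [NormedAddCommGroup E] [NormedSpace ℝ E] [MeasurableSpace E]
    [BorelSpace E] {Ω : Type*} [MeasurableSpace Ω] {P : Measure Ω} {G : Ω → ℝ} (hG : Measurable G)
    (hi : Integrable G P) {S : Ω → E} (hS : Measurable S) :
    IsSignedTransform fun L : StrongDual ℝ E =>
      ∫ ω, (G ω : ℂ) * Complex.exp (L (S ω) * Complex.I) ∂P := by
  have h1 := isFiniteMeasure_withDensity_ofReal hi.2
  have h2 := isFiniteMeasure_withDensity_ofReal hi.neg.2
  have key : ∀ g : Ω → ℝ, Measurable g → ∀ L : StrongDual ℝ E,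
      charFunDual ((P.withDensity fun ω => ENNReal.ofReal (g ω)).map S) L =
        ∫ ω, (max (g ω) 0 : ℝ) * Complex.exp (L (S ω) * Complex.I) ∂P := by
    intro g hg L
    rw [charFunDual_apply, integral_map hS.aemeasurable (by fun_prop),
      integral_withDensity_eq_integral_toReal_smul hg.ennreal_ofReal (by simp)]
    rfl
  have hint : ∀ g : Ω → ℝ, Integrable g P → ∀ L : StrongDual ℝ E,
      Integrable (fun ω => ((max (g ω) 0 : ℝ) : ℂ) * Complex.exp (L (S ω) * Complex.I)) P := by
    intro g hg L
    refine hg.pos_part.norm.mono' (hg.pos_part.ofReal.aestronglyMeasurable.mul ?_)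
      (.of_forall fun ω => ?_)
    · exact Measurable.aestronglyMeasurable (by fun_prop)
    · rw [norm_mul, Complex.norm_exp_ofReal_mul_I, mul_one, Complex.norm_real]
  refine ⟨(P.withDensity fun ω => ENNReal.ofReal (G ω)).map S,
    (P.withDensity fun ω => ENNReal.ofReal ((-G) ω)).map S, inferInstance, inferInstance,
    fun L => ?_⟩
  rw [key G hG, key (-G) hG.neg, ← integral_sub (hint G hi L) (hint (-G) hi.neg L)]
  refine integral_congr_ae (.of_forall fun ω => ?_)
  simp only [← sub_mul, ← Complex.ofReal_sub, Pi.neg_apply]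
  congr 2
  rcases le_total 0 (G ω) with h | h
  · rw [max_eq_left h, max_eq_right (by linarith), sub_zero]
  · rw [max_eq_right h, max_eq_left (by linarith)]; ring

end IsSignedTransform

lemma isSignedTransform_resolventSymbol (d : ℕ) :
    IsSignedTransform fun L : StrongDual ℝ (Fin d → ℝ) => resolventSymbol 1 L := by
  have := IsSignedTransform.of_density (measurable_subDens d 1) (integrable_subDens d one_pos)
    (S := Prod.snd) measurable_snd
  simpa only [integral_subDens_cexp d one_pos, resolventSymbol] using this

lemma measurable_gradDens (d : ℕ) (l : Fin d) : Measurable (gradDens d l) := by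
  unfold gradDens
  refine Measurable.mul (by fun_prop) (Finset.measurable_prod _ fun k _ => ?_)
  have hk : Measurable fun p : ℝ × (Fin d → ℝ) => p.2 k := by fun_prop
  split_ifs
  · exact hk.mul (measurable_heat_uncurry measurable_fst hk)
  · exact measurable_heat_uncurry measurable_fst hk

lemma isSignedTransform_gradSymbol (d : ℕ) (l : Fin d) :
    IsSignedTransform fun L : StrongDual ℝ (Fin d → ℝ) =>
      Complex.I * L (Pi.single l 1) * resolventSymbol 1 L := by
  have := IsSignedTransform.of_density (measurable_gradDens d l) (integrable_gradDens d l)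
    (S := Prod.snd) measurable_snd
  simpa only [integral_gradDens_cexp d l, resolventSymbol, Complex.ofReal_one, one_mul] using this

lemma resolventSymbol_mul_cancel {d : ℕ} {A : ℝ} (hA : 0 ≤ A) (L : StrongDual ℝ (Fin d → ℝ)) :
    resolventSymbol A L * (1 + A * ∑ k, (L (Pi.single k 1) : ℂ) ^ 2) = 1 := by
  refine inv_mul_cancel₀ ?_
  have : 0 < 1 + A * ∑ k, L (Pi.single k 1) ^ 2 := by positivity
  exact_mod_cast this.ne'

lemma isSignedTransform_prod_resolventSymbol [SecondCountableTopology F] {d : ℕ} {J : Type*}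
    [Fintype J] [DecidableEq J] (T : J → (Fin d → ℝ) →L[ℝ] F) :
    IsSignedTransform fun L : StrongDual ℝ F => (∏ j, resolventSymbol 1 (L ∘SL T j)) *
      (1 + ∑ l, (∑ j, ((L ∘SL T j) (Pi.single l 1) : ℂ)) ^ 2) := by
  have hk := fun j => (isSignedTransform_resolventSymbol d).comp_dual (T j)
  have he := fun j l => (isSignedTransform_gradSymbol d l).comp_dual (T j)
  have key : ∀ L : StrongDual ℝ F, (∏ j, resolventSymbol 1 (L ∘SL T j)) *
      (1 + ∑ l, (∑ j, ((L ∘SL T j) (Pi.single l 1) : ℂ)) ^ 2) =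
      (∏ j, resolventSymbol 1 (L ∘SL T j)) + ∑ i, ∑ j, (∑ l, ((L ∘SL T i) (Pi.single l 1) : ℂ) *
        ((L ∘SL T j) (Pi.single l 1) : ℂ)) * ∏ j, resolventSymbol 1 (L ∘SL T j) := by
    intro L
    rw [mul_add, mul_one, mul_comm]
    simp only [← Finset.sum_mul, sq, Finset.sum_mul_sum]
    congr 2
    rw [Finset.sum_comm]
    exact Finset.sum_congr rfl fun i _ => Finset.sum_comm
  simp only [key]
  refine (IsSignedTransform.prod _ fun j _ => hk j).add
    (IsSignedTransform.sum _ fun i _ => IsSignedTransform.sum _ fun j _ => ?_)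
  by_cases hij : i = j
  · subst hij
    have h1 : ∀ L : StrongDual ℝ F, (∑ l, ((L ∘SL T i) (Pi.single l 1) : ℂ) *
        ((L ∘SL T i) (Pi.single l 1) : ℂ)) * ∏ j, resolventSymbol 1 (L ∘SL T j) =
        (1 - resolventSymbol 1 (L ∘SL T i)) *
          ∏ j ∈ Finset.univ.erase i, resolventSymbol 1 (L ∘SL T j) := by
      intro L
      have h2 := resolventSymbol_mul_cancel zero_le_one (L ∘SL T i)
      rw [Complex.ofReal_one, one_mul] at h2
      simp only [← sq]
      rw [← Finset.mul_prod_erase _ _ (Finset.mem_univ i)]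
      linear_combination (∏ j ∈ Finset.univ.erase i, resolventSymbol 1 (L ∘SL T j)) * h2
    simp only [h1]
    exact (IsSignedTransform.one.sub (hk i)).mul (IsSignedTransform.prod _ fun j _ => hk j)
  · have h1 : ∀ L : StrongDual ℝ F, (∑ l, ((L ∘SL T i) (Pi.single l 1) : ℂ) *
        ((L ∘SL T j) (Pi.single l 1) : ℂ)) * ∏ j, resolventSymbol 1 (L ∘SL T j) =
        -((∑ l, (Complex.I * (L ∘SL T i) (Pi.single l 1) * resolventSymbol 1 (L ∘SL T i)) *
          (Complex.I * (L ∘SL T j) (Pi.single l 1) * resolventSymbol 1 (L ∘SL T j))) *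
          ∏ j ∈ (Finset.univ.erase i).erase j, resolventSymbol 1 (L ∘SL T j)) := by
      intro L
      rw [← Finset.mul_prod_erase _ _ (Finset.mem_univ i), ← Finset.mul_prod_erase _ _
        (Finset.mem_erase.2 ⟨Ne.symm hij, Finset.mem_univ j⟩), Finset.sum_mul, Finset.sum_mul,
        ← Finset.sum_neg_distrib]
      refine Finset.sum_congr rfl fun l _ => ?_
      linear_combination ((((L ∘SL T i) (Pi.single l 1) : ℝ) : ℂ) *
        (((L ∘SL T j) (Pi.single l 1) : ℝ) : ℂ) * resolventSymbol 1 (L ∘SL T i) *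
        resolventSymbol 1 (L ∘SL T j) *
        ∏ j ∈ (Finset.univ.erase i).erase j, resolventSymbol 1 (L ∘SL T j)) * Complex.I_sq
    simp only [h1]
    exact ((IsSignedTransform.sum _ fun l _ => (he i l).mul (he j l)).mul
      (IsSignedTransform.prod _ fun j _ => hk j)).neg

end FourierStieltjes

section Densities

variable {d m : ℕ}

/-- The measure with real density `p`. -/
noncomputable abbrev densityMeasure {X : Type*} [MeasureSpace X] (p : X → ℝ) : Measure X :=
  volume.withDensity fun x => ENNReal.ofReal (p x)

lemma integral_densityMeasure {X G : Type*} [MeasureSpace X] [NormedAddCommGroup G]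
    [NormedSpace ℝ G] {p : X → ℝ} (hp : Measurable p) (hp0 : ∀ x, 0 ≤ p x) (g : X → G) :
    ∫ x, g x ∂densityMeasure p = ∫ x, p x • g x := by
  rw [integral_withDensity_eq_integral_toReal_smul hp.ennreal_ofReal (by simp)]
  simp only [ENNReal.toReal_ofReal (hp0 _)]

lemma densityMeasure_pi {p : (Fin d → ℝ) → ℝ} (hp : Measurable p) (hp0 : ∀ x, 0 ≤ p x)
    (hi : Integrable p) :
    densityMeasure (fun y : Fin m → Fin d → ℝ => ∏ j, p (y j)) =
      Measure.pi fun _ => densityMeasure p := by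
  have h1 : IsFiniteMeasure (densityMeasure p) := isFiniteMeasure_withDensity_ofReal hi.2
  have h2 : IsFiniteMeasure (densityMeasure fun y : Fin m → Fin d → ℝ => ∏ j, p (y j)) :=
    isFiniteMeasure_withDensity_ofReal (Integrable.fintype_prod (f := fun _ => p) fun _ => hi).2
  have hpm : Measurable fun y : Fin m → Fin d → ℝ => ∏ j, p (y j) :=
    Finset.measurable_prod _ fun j _ => hp.comp (measurable_pi_apply j)
  refine Measure.ext_of_charFunDual (funext fun L => ?_)
  rw [charFunDual_pi, charFunDual_apply, integral_densityMeasure hpm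
    (fun y => Finset.prod_nonneg fun _ _ => hp0 _)]
  simp only [charFunDual_apply]
  simp only [integral_densityMeasure hp hp0]
  rw [← integral_fintype_prod_volume_eq_prod (𝕜 := ℂ) (fun j v => p v •
    Complex.exp (((L ∘SL ContinuousLinearMap.single ℝ (fun _ : Fin m => Fin d → ℝ) j) v : ℝ) *
      Complex.I))]
  refine integral_congr_ae (.of_forall fun y => ?_)
  simp only [Complex.real_smul]
  rw [Finset.prod_mul_distrib, ← Complex.exp_sum, ← Finset.sum_mul]
  congr 3
  · push_cast; rfl
  · rw [← Complex.ofReal_sum]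
    congr 1
    conv_lhs => rw [← Finset.univ_sum_single y, map_sum]
    rfl

/-- The density of `m + 1` independent copies, the first of which is singled out. -/
noncomputable abbrev jointDens (m : ℕ) (p : (Fin d → ℝ) → ℝ)
    (q : (Fin d → ℝ) × (Fin m → Fin d → ℝ)) : ℝ := p q.1 * ∏ j, p (q.2 j)

lemma measurable_jointDens {p : (Fin d → ℝ) → ℝ} (hp : Measurable p) :
    Measurable (jointDens m p) :=
  (hp.comp measurable_fst).mul (Finset.measurable_prod _ fun j _ =>
    hp.comp ((measurable_pi_apply j).comp measurable_snd))

lemma jointDens_nonneg {p : (Fin d → ℝ) → ℝ} (hp0 : ∀ x, 0 ≤ p x)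
    (q : (Fin d → ℝ) × (Fin m → Fin d → ℝ)) : 0 ≤ jointDens m p q :=
  mul_nonneg (hp0 _) (Finset.prod_nonneg fun _ _ => hp0 _)

lemma integrable_jointDens {p : (Fin d → ℝ) → ℝ} (hi : Integrable p) :
    Integrable (jointDens m p) :=
  hi.mul_prod (g := fun y : Fin m → Fin d → ℝ => ∏ j, p (y j))
    (Integrable.fintype_prod (f := fun _ => p) fun _ => hi)

lemma densityMeasure_jointDens {p : (Fin d → ℝ) → ℝ} (hp : Measurable p) (hp0 : ∀ x, 0 ≤ p x)
    (hi : Integrable p) :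
    densityMeasure (jointDens m p) =
      (densityMeasure p).prod (Measure.pi fun _ => densityMeasure p) := by
  have hpm : Measurable fun y : Fin m → Fin d → ℝ => ∏ j, p (y j) :=
    Finset.measurable_prod _ fun j _ => hp.comp (measurable_pi_apply j)
  rw [← densityMeasure_pi hp hp0 hi, prod_withDensity hp.ennreal_ofReal hpm.ennreal_ofReal]
  rw [densityMeasure, Measure.volume_eq_prod]
  congr 1
  funext q
  exact ENNReal.ofReal_mul (hp0 q.1)

/-- The coordinate embeddings of `ℝ^d` into `ℝ^d × (ℝ^d)^m`. -/
noncomputable def coordEmb (d m : ℕ) :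
    Option (Fin m) → (Fin d → ℝ) →L[ℝ] (Fin d → ℝ) × (Fin m → Fin d → ℝ)
  | none => ContinuousLinearMap.inl ℝ _ _
  | some j => ContinuousLinearMap.inr ℝ _ _ ∘SL
      ContinuousLinearMap.single ℝ (fun _ : Fin m => Fin d → ℝ) j

lemma charFunDual_jointDens {p : (Fin d → ℝ) → ℝ} (hp : Measurable p) (hp0 : ∀ x, 0 ≤ p x)
    (hi : Integrable p) (L : StrongDual ℝ ((Fin d → ℝ) × (Fin m → Fin d → ℝ))) :
    charFunDual (densityMeasure (jointDens m p)) L =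
      ∏ j, charFunDual (densityMeasure p) (L ∘SL coordEmb d m j) := by
  have h1 : IsFiniteMeasure (densityMeasure p) := isFiniteMeasure_withDensity_ofReal hi.2
  rw [densityMeasure_jointDens hp hp0 hi, charFunDual_prod, charFunDual_pi, Fintype.prod_option]
  rfl

/-- The diagonal embedding of `ℝ^d` into `ℝ^d × (ℝ^d)^m`. -/
noncomputable def diagEmb (d m : ℕ) : (Fin d → ℝ) →L[ℝ] (Fin d → ℝ) × (Fin m → Fin d → ℝ) :=
  (ContinuousLinearMap.id ℝ _).prod (ContinuousLinearMap.pi fun _ => ContinuousLinearMap.id ℝ _)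

lemma dual_diagEmb (L : StrongDual ℝ ((Fin d → ℝ) × (Fin m → Fin d → ℝ))) (x : Fin d → ℝ) :
    (L ∘SL diagEmb d m) x = ∑ j, (L ∘SL coordEmb d m j) x := by
  simp only [ContinuousLinearMap.comp_apply, ← map_sum]
  congr 1
  rw [Fintype.sum_option]
  ext j
  · simp [diagEmb, coordEmb, Prod.fst_sum]
  · simp [diagEmb, coordEmb, Prod.snd_sum, Finset.sum_apply, Pi.single_apply]

lemma resolventSymbol_smul {A a : ℝ} (ha : a ^ 2 = A) (L : StrongDual ℝ (Fin d → ℝ)) :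
    resolventSymbol 1 (a • L) = resolventSymbol A L := by
  simp only [resolventSymbol, ← ha, FunLike.coe_smul, Pi.smul_apply, smul_eq_mul,
    Complex.ofReal_mul, mul_pow, ← Finset.mul_sum]
  simp

end Densities

/-- The law of `m + 1` independent copies with density `K_μ^{*h}` is the convolution of a finite
signed measure, rescaled by `μ ^ (1 / σ)`, with the diagonal law of density `K_μ^{*h}`. -/
lemma exists_signed_factorization (d m h : ℕ) (hh : 1 ≤ h) (σ : ℝ) :
    ∃ p n : Measure ((Fin d → ℝ) × (Fin m → Fin d → ℝ)), IsFiniteMeasure p ∧ IsFiniteMeasure n ∧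
      ∀ μ : ℝ, 0 < μ → ∃ a : ℝ,
        densityMeasure (jointDens m (kdR d σ μ h)) +
          n.map (fun x => a • x) ∗ (densityMeasure (kdR d σ μ h)).map (diagEmb d m) =
        p.map (fun x => a • x) ∗ (densityMeasure (kdR d σ μ h)).map (diagEmb d m) := by
  obtain ⟨p, n, hp, hn, hpn⟩ := (isSignedTransform_prod_resolventSymbol (coordEmb d m)).pow h
  refine ⟨p, n, hp, hn, fun μ hμ => ⟨√(μ ^ ((2 : ℝ) / σ)), ?_⟩⟩
  have hA := rpow_two_div_pos (σ := σ) hμ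
  set A := μ ^ ((2 : ℝ) / σ) with hAdef
  have ha : √A ^ 2 = A := Real.sq_sqrt hA.le
  set a := √A
  have hm := measurable_kdR d (σ := σ) hμ h
  have hi := integrable_kdR d (σ := σ) hμ h
  have h0 : ∀ x, 0 ≤ kdR d σ μ h x := fun x => ENNReal.toReal_nonneg
  have f1 : IsFiniteMeasure (densityMeasure (kdR d σ μ h)) :=
    isFiniteMeasure_withDensity_ofReal hi.2
  have f2 : IsFiniteMeasure (densityMeasure (jointDens m (kdR d σ μ h))) :=
    isFiniteMeasure_withDensity_ofReal (integrable_jointDens hi).2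
  have hc : ∀ L, charFunDual (densityMeasure (kdR d σ μ h)) L = resolventSymbol A L ^ h := by
    intro L
    rw [densityMeasure, withDensity_kdR d hμ, charFunDual_kdens d hμ, Nat.sub_add_cancel hh]
  have hmap : ∀ q : Measure ((Fin d → ℝ) × (Fin m → Fin d → ℝ)), ∀ L,
      charFunDual (q.map fun x => a • x) L = charFunDual q (a • L) := by
    intro q L
    have hL : L ∘SL (a • ContinuousLinearMap.id ℝ _) = a • L := by ext <;> simp
    rw [← hL, ← charFunDual_map]
    rfl
  refine Measure.ext_of_charFunDual (funext fun L => ?_)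
  rw [charFunDual_add_measure, charFunDual_conv, charFunDual_conv, hmap, hmap, charFunDual_map,
    charFunDual_jointDens hm h0 hi, hc]
  simp only [hc]
  have h1 := hpn (a • L)
  simp only [ContinuousLinearMap.smul_comp, resolventSymbol_smul ha] at h1
  have h2 := resolventSymbol_mul_cancel hA.le (L ∘SL diagEmb d m)
  simp only [dual_diagEmb, Complex.ofReal_sum] at h2
  have h3 : (1 : ℂ) + ∑ l, (∑ j, (((a • L ∘SL coordEmb d m j) (Pi.single l 1) : ℝ) : ℂ)) ^ 2 =
      1 + A * ∑ l, (∑ j, (((L ∘SL coordEmb d m j) (Pi.single l 1) : ℝ) : ℂ)) ^ 2 := by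
    simp only [FunLike.coe_smul, Pi.smul_apply, smul_eq_mul, Complex.ofReal_mul,
      ← Finset.mul_sum, mul_pow]
    rw [← ha]
    push_cast
    rfl
  rw [h3] at h1
  rw [Finset.prod_pow]
  set P := ∏ j, resolventSymbol A (L ∘SL coordEmb d m j)
  set X := (1 : ℂ) + A * ∑ l, (∑ j, (((L ∘SL coordEmb d m j) (Pi.single l 1) : ℝ) : ℂ)) ^ 2
  set R := resolventSymbol A (L ∘SL diagEmb d m)
  have h4 : (P * X) ^ h * R ^ h = P ^ h := by rw [← mul_pow, mul_assoc, mul_comm X, h2, mul_one]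
  linear_combination -h4 + R ^ h * h1

section MixedNorm

variable {d m : ℕ}

/-- The test function that is obtained by pairing the kernel at `x` with `φ`. -/
noncomputable abbrev pairingFun (v : (Fin d → ℝ) → ℝ) (φ : (Fin m → Fin d → ℝ) → ℝ)
    (x : Fin d → ℝ) (q : (Fin d → ℝ) × (Fin m → Fin d → ℝ)) : ℝ :=
  v (x - q.1) * φ fun j => q.2 j + (x - q.1)

variable {v : (Fin d → ℝ) → ℝ} {φ : (Fin m → Fin d → ℝ) → ℝ}

lemma measurable_pairingFun (hv : Continuous v) (hφ : Measurable φ) (x : Fin d → ℝ) :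
    Measurable (pairingFun v φ x) := by
  refine Measurable.mul (by fun_prop) (hφ.comp (measurable_pi_lambda _ fun j => ?_))
  exact ((measurable_pi_apply j).comp measurable_snd).add (measurable_const.sub measurable_fst)

lemma integrable_pairingFun (hv : Continuous v) {M : ℝ} (hM : ∀ x, ‖v x‖ ≤ M)
    (hφ : Measurable φ) (hφ1 : ∀ y, ‖φ y‖ ≤ 1) (x : Fin d → ℝ)
    (Q : Measure ((Fin d → ℝ) × (Fin m → Fin d → ℝ))) [IsFiniteMeasure Q] :
    Integrable (pairingFun v φ x) Q := by
  refine Integrable.of_bound (measurable_pairingFun hv hφ x).aestronglyMeasurable M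
    (.of_forall fun q => ?_)
  rw [norm_mul]
  simpa using mul_le_mul (hM (x - q.1)) (hφ1 fun j => q.2 j + (x - q.1)) (norm_nonneg _)
    ((norm_nonneg _).trans (hM 0))

lemma norm_integral_pairingFun_le {p : (Fin d → ℝ) → ℝ} (hp : Measurable p) (hp0 : ∀ x, 0 ≤ p x)
    (hi : Integrable p) (hv : Continuous v) {M B : ℝ} (hM : ∀ x, ‖v x‖ ≤ M)
    (hB : ∀ x, ‖∫ z, p (x - z) * v z‖ ≤ B) (hφ : Measurable φ) (hφ1 : ∀ y, ‖φ y‖ ≤ 1)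
    (x : Fin d → ℝ) (Q : Measure ((Fin d → ℝ) × (Fin m → Fin d → ℝ))) [IsFiniteMeasure Q] :
    ‖∫ q, pairingFun v φ x q ∂(Q ∗ (densityMeasure p).map (diagEmb d m))‖ ≤
      B * Q.real Set.univ := by
  have h1 : IsFiniteMeasure (densityMeasure p) := isFiniteMeasure_withDensity_ofReal hi.2
  rw [integral_conv (integrable_pairingFun hv hM hφ hφ1 x _)]
  refine norm_integral_le_of_norm_le_const (.of_forall fun q => ?_)
  have h2 : Measurable fun w => pairingFun v φ x (q + w) :=
    (measurable_pairingFun hv hφ x).comp (measurable_const_add q)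
  rw [integral_map (diagEmb d m).continuous.aemeasurable h2.aestronglyMeasurable]
  have h3 : ∀ w, pairingFun v φ x (q + diagEmb d m w) =
      v (x - q.1 - w) * φ fun j => q.2 j + (x - q.1) := by
    intro w
    simp only [pairingFun, diagEmb, ContinuousLinearMap.prod_apply, Prod.fst_add, Prod.snd_add,
      ContinuousLinearMap.id_apply, ContinuousLinearMap.pi_apply, Pi.add_apply]
    congr 2
    · abel
    · funext j
      abel
  have h4 : ∫ w, p w * v (x - q.1 - w) = ∫ z, p (x - q.1 - z) * v z := by
    rw [← integral_sub_left_eq_self _ _ (x - q.1)]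
    simp
  simp only [h3, integral_densityMeasure hp hp0, smul_eq_mul, ← mul_assoc]
  rw [integral_mul_const, h4, norm_mul]
  simpa using mul_le_mul (hB (x - q.1)) (hφ1 fun j => q.2 j + (x - q.1)) (norm_nonneg _)
    ((norm_nonneg _).trans (hB 0))

lemma measurePreserving_sub_shift (x : Fin d → ℝ) :
    MeasurePreserving (fun q : (Fin d → ℝ) × (Fin m → Fin d → ℝ) =>
      (x - q.1, fun j => q.2 j + (x - q.1))) := by
  refine (volume.measurePreserving_sub_left x).skew_product
    (g := fun w (u : Fin m → Fin d → ℝ) j => u j + (x - w)) ?_ (.of_forall fun w => ?_)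
  · refine measurable_pi_lambda _ fun j => ?_
    exact ((measurable_pi_apply j).comp measurable_snd).add (measurable_const.sub measurable_fst)
  · exact map_add_right_eq_self volume fun _ : Fin m => x - w

lemma lintegral_mixed_le {p : (Fin d → ℝ) → ℝ} (hp : Measurable p) (hp0 : ∀ x, 0 ≤ p x)
    (hi : Integrable p) (hv : Continuous v) {M B : ℝ} (hM : ∀ x, ‖v x‖ ≤ M)
    (hB : ∀ x, ‖∫ z, p (x - z) * v z‖ ≤ B)
    {P N : Measure ((Fin d → ℝ) × (Fin m → Fin d → ℝ))} [IsFiniteMeasure P] [IsFiniteMeasure N]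
    (hPN : densityMeasure (jointDens m p) + N ∗ (densityMeasure p).map (diagEmb d m) =
      P ∗ (densityMeasure p).map (diagEmb d m)) (x : Fin d → ℝ) :
    ∫⁻ y : Fin m → Fin d → ℝ, (‖∫ z, p (x - z) * (∏ j, p (y j - z)) * v z‖₊ : ℝ≥0∞) ≤
      ENNReal.ofReal ((P.real Set.univ + N.real Set.univ) * B) := by
  have f1 : IsFiniteMeasure (densityMeasure p) := isFiniteMeasure_withDensity_ofReal hi.2
  have f2 : IsFiniteMeasure (densityMeasure (jointDens m p)) :=
    isFiniteMeasure_withDensity_ofReal (integrable_jointDens hi).2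
  set H : (Fin d → ℝ) × (Fin m → Fin d → ℝ) → ℝ :=
    fun q => p (x - q.1) * (∏ j, p (q.2 j - q.1)) * v q.1 with hH
  have hHm : Measurable H := by
    refine ((hp.comp (measurable_const.sub measurable_fst)).mul
      (Finset.measurable_prod _ fun j _ => hp.comp ?_)).mul (hv.measurable.comp measurable_fst)
    exact ((measurable_pi_apply j).comp measurable_snd).sub measurable_fst
  have hT := measurePreserving_sub_shift (m := m) x
  have hHT : ∀ q : (Fin d → ℝ) × (Fin m → Fin d → ℝ),
      H (x - q.1, fun j => q.2 j + (x - q.1)) = jointDens m p q * v (x - q.1) := by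
    intro q
    simp [hH, jointDens]
  have hHi : Integrable H := by
    rw [← hT.integrable_comp hHm.aestronglyMeasurable]
    refine Integrable.congr (f := fun q => jointDens m p q * v (x - q.1)) ?_
      (.of_forall fun q => (hHT q).symm)
    exact (integrable_jointDens hi).mul_bdd (c := M)
      (hv.measurable.comp (measurable_const.sub measurable_fst)).aestronglyMeasurable
      (.of_forall fun q => hM _)
  set R : (Fin m → Fin d → ℝ) → ℝ := fun y => ∫ z, H (z, y) with hR
  have hRm : Measurable R := by
    have := hHm.stronglyMeasurable.integral_prod_left' (μ := (volume : Measure (Fin d → ℝ)))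
    exact this.measurable
  have hRi : Integrable R := hHi.integral_prod_right
  set φ : (Fin m → Fin d → ℝ) → ℝ := fun y => if 0 ≤ R y then 1 else -1 with hφdef
  have hφ : Measurable φ :=
    Measurable.ite (measurableSet_le measurable_const hRm) measurable_const measurable_const
  have hφ1 : ∀ y, ‖φ y‖ ≤ 1 := by
    intro y
    simp only [hφdef]
    split_ifs <;> simp
  have hRφ : ∀ y, R y * φ y = ‖R y‖ := by
    intro y
    simp only [hφdef]
    split_ifs with h
    · rw [mul_one, Real.norm_of_nonneg h]
    · rw [mul_neg_one, Real.norm_of_nonpos (not_le.1 h).le]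
  have hpair : ∫ y, ‖R y‖ = ∫ q, pairingFun v φ x q ∂densityMeasure (jointDens m p) := by
    rw [integral_densityMeasure (measurable_jointDens hp) (jointDens_nonneg hp0)]
    have h1 : ∫ q, H q * φ q.2 = ∫ y, ‖R y‖ := by
      rw [Measure.volume_eq_prod, integral_prod_symm]
      · simp only [integral_mul_const]
        exact integral_congr_ae (.of_forall hRφ)
      · exact hHi.mul_bdd (c := 1) (hφ.comp measurable_snd).aestronglyMeasurable
          (.of_forall fun q => hφ1 _)
    have h2 : AEStronglyMeasurable (fun q => H q * φ q.2) (volume.map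
        fun q : (Fin d → ℝ) × (Fin m → Fin d → ℝ) => (x - q.1, fun j => q.2 j + (x - q.1))) :=
      (hHm.mul (hφ.comp measurable_snd)).aestronglyMeasurable
    have h3 := integral_map hT.measurable.aemeasurable h2
    rw [hT.map_eq] at h3
    rw [← h1, h3]
    refine integral_congr_ae (.of_forall fun q => ?_)
    simp only [hHT, smul_eq_mul, pairingFun, mul_assoc]
  have hsum := congrArg (fun Q => ∫ q, pairingFun v φ x q ∂Q) hPN
  rw [integral_add_measure (integrable_pairingFun hv hM hφ hφ1 x _)
    (integrable_pairingFun hv hM hφ hφ1 x _), ← hpair] at hsum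
  have e1 := norm_integral_pairingFun_le hp hp0 hi hv hM hB hφ hφ1 x P
  have e2 := norm_integral_pairingFun_le hp hp0 hi hv hM hB hφ hφ1 x N
  change ∫⁻ y, (‖R y‖ₑ) ≤ _
  rw [← ofReal_integral_norm_eq_lintegral_enorm hRi]
  refine ENNReal.ofReal_le_ofReal ?_
  rw [Real.norm_eq_abs, abs_le] at e1 e2
  linarith [e1.2, e2.1]

end MixedNorm

/-- for `h ≥ 1`, `m ∈ ℕ` there is `C = C(d,σ,h,m) > 0` such that for every
`μ > 0` and every bounded continuous `2π`-periodic `v`, the function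
`W(x;y₁,…,y_m) := ∫ K_μ^{*h}(x−z) ∏ⱼ K_μ^{*h}(yⱼ−z) v(z) dz` satisfies
`‖W‖_{𝒱^m} ≤ C ‖K_μ^{*h} ∗ v‖_{L^∞}`. -/
theorem stmt12 (d : ℕ) (hd : 1 ≤ d) (σ : ℝ) (hσ : 0 < σ) (h : ℕ) (hh : 1 ≤ h) (m : ℕ) :
    ∃ C : ℝ, 0 < C ∧ ∀ μ : ℝ, 0 < μ → ∀ v : (Fin d → ℝ) → ℝ, Continuous v →
      (∃ M : ℝ, ∀ x, ‖v x‖ ≤ M) →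
      (∀ (x : Fin d → ℝ) (k : Fin d → ℤ), v (x + fun i => 2 * π * (k i : ℝ)) = v x) →
      Vnorm d m (fun x y => ∫ z : Fin d → ℝ,
          kdR d σ μ h (x - z) * (∏ j, kdR d σ μ h (y j - z)) * v z) ≤
        ENNReal.ofReal C *
          ⨆ x : Fin d → ℝ, (‖∫ z : Fin d → ℝ, kdR d σ μ h (x - z) * v z‖₊ : ℝ≥0∞) := by
  obtain ⟨p, n, hp, hn, hpn⟩ := exists_signed_factorization d m h hh σ
  refine ⟨p.real Set.univ + n.real Set.univ + 1, by positivity, fun μ hμ v hv ⟨M, hM⟩ _ => ?_⟩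
  obtain ⟨a, ha⟩ := hpn μ hμ
  have hm := measurable_kdR d (σ := σ) hμ h
  have hi := integrable_kdR d (σ := σ) hμ h
  have h0 : ∀ x, 0 ≤ kdR d σ μ h x := fun x => ENNReal.toReal_nonneg
  set S := ⨆ x : Fin d → ℝ, (‖∫ z : Fin d → ℝ, kdR d σ μ h (x - z) * v z‖₊ : ℝ≥0∞)
  have hS : S ≠ ∞ := by
    refine ne_top_of_le_ne_top ENNReal.ofReal_ne_top (b := ENNReal.ofReal
      (∫ z, kdR d σ μ h z * M)) (iSup_le fun x => ?_)
    change ‖∫ z, kdR d σ μ h (x - z) * v z‖ₑ ≤ _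
    rw [← ofReal_norm]
    refine ENNReal.ofReal_le_ofReal ?_
    rw [← integral_sub_left_eq_self (fun z => kdR d σ μ h z * M) volume x]
    refine norm_integral_le_of_norm_le ((hi.mul_const M).comp_sub_left x) (.of_forall fun z => ?_)
    rw [norm_mul, Real.norm_of_nonneg (h0 _)]
    exact mul_le_mul_of_nonneg_left (hM _) (h0 _)
  have hB : ∀ x, ‖∫ z, kdR d σ μ h (x - z) * v z‖ ≤ S.toReal := fun x =>
    ENNReal.toReal_mono hS
      (le_iSup (fun x => (‖∫ z : Fin d → ℝ, kdR d σ μ h (x - z) * v z‖₊ : ℝ≥0∞)) x)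
  have hmass : ∀ q : Measure ((Fin d → ℝ) × (Fin m → Fin d → ℝ)),
      (q.map fun x => a • x).real Set.univ = q.real Set.univ := fun q => by
    rw [map_measureReal_apply (measurable_const_smul a) MeasurableSet.univ, Set.preimage_univ]
  refine iSup_le fun x => (lintegral_mixed_le hm h0 hi hv hM hB ha x).trans ?_
  rw [hmass, hmass]
  conv_rhs => rw [← ENNReal.ofReal_toReal hS]
  rw [← ENNReal.ofReal_mul (by positivity)]
  exact ENNReal.ofReal_le_ofReal
    (mul_le_mul_of_nonneg_right (le_add_of_nonneg_right zero_le_one) ENNReal.toReal_nonneg)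
end
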